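/- arXiv:2202.08140 — 3 statements merged into one kernel-verified Lean document; each statement's English description precedes it below -/
import Mathlib

section
/- A C*-algebra A is a weakly Rickart C*-algebra if and only if: for every x ∈ A there exists a partial isometry e ∈ A such that A(x) ⊆ A₂(e), x is a positive element of the C*-algebra (A₂(e), •_e, *_e) (equivalently, x ∈ A₂(e) and e* x is positive in A), and A₀(e) = {x}^⊥. -/
/-- A projection in a C*-algebra: a self-adjoint idempotent. -/
def IsProjection {A : Type*} [Mul A] [Star A] (p : A) : Prop :=
  star p = p ∧ p * p = p

/-- A partial isometry: an element `e` such that `e * e*` is a projection. -/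
def IsPartialIsometry {A : Type*} [Mul A] [Star A] (e : A) : Prop :=
  IsProjection (e * star e)

/-- `p` is an annihilating right projection (ARP) of `x`. -/
def IsARP {A : Type*} [Mul A] [Star A] [Zero A] (x p : A) : Prop :=
  IsProjection p ∧ x * p = x ∧ ∀ y : A, x * y = 0 → p * y = 0

/-- A C*-algebra is weakly Rickart if every element admits an ARP. -/
def WeaklyRickart (A : Type*) [NonUnitalCStarAlgebra A] : Prop :=
  ∀ x : A, ∃ p : A, IsARP x p

/-- The Peirce-2 subspace associated with a partial isometry `e`. -/
def Peirce2 {A : Type*} [Mul A] [Star A] (e : A) : Set A :=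
  {z : A | e * star e * z * (star e * e) = z}

/-- The Peirce-0 subspace associated with a partial isometry `e`. -/
def Peirce0 {A : Type*} [Mul A] [Star A] [Zero A] (e : A) : Set A :=
  {z : A | e * star e * z = 0 ∧ z * (star e * e) = 0}

/-- The inner ideal of `A` generated by `x`: the norm closure of `x A x`. -/
def innerIdealGen {A : Type*} [NonUnitalCStarAlgebra A] (x : A) : Set A :=
  closure {z : A | ∃ a : A, z = x * a * x}

/-- The orthogonal annihilator of a single element `x`. -/
def orthAnnihilator {A : Type*} [Mul A] [Star A] [Zero A] (x : A) : Set A :=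
  {y : A | x * star y = 0 ∧ star y * x = 0}

namespace RickartPolar

/-- A unital star ring in which every element has a left projection. -/
class IsRickart (A : Type*) [Ring A] [StarRing A] : Prop where
  exists_leftProj : ∀ x : A, ∃ p : A, IsStarProjection p ∧ p * x = x ∧ ∀ y, y * x = 0 → y * p = 0

section LeftProjection

variable {A : Type*} [Ring A] [StarRing A] [IsRickart A]

/-- The left projection of an element of a Rickart star ring. -/
noncomputable def lp (x : A) : A := (IsRickart.exists_leftProj x).choose

lemma isStarProjection_lp (x : A) : IsStarProjection (lp x) :=
  (IsRickart.exists_leftProj x).choose_spec.1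

lemma star_lp (x : A) : star (lp x) = lp x := (isStarProjection_lp x).isSelfAdjoint

lemma lp_mul_lp (x : A) : lp x * lp x = lp x := (isStarProjection_lp x).isIdempotentElem

lemma lp_mul (x : A) : lp x * x = x := (IsRickart.exists_leftProj x).choose_spec.2.1

lemma mul_lp {x y : A} (h : y * x = 0) : y * lp x = 0 :=
  (IsRickart.exists_leftProj x).choose_spec.2.2 y h

lemma lp_mul_eq_zero {x y : A} (h : star x * y = 0) : lp x * y = 0 := by
  have := mul_lp (x := x) (y := star y) (by rw [← star_star x, ← star_mul, h, star_zero])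
  rw [← star_lp, ← star_star y, ← star_mul, this, star_zero]

lemma mul_lp_eq_of_mul_eq {x p : A} (h : p * x = x) : p * lp x = lp x := by
  have := mul_lp (x := x) (y := p - 1) (by rw [sub_mul, h, one_mul, sub_self])
  rwa [sub_mul, one_mul, sub_eq_zero] at this

lemma lp_mul_eq_of_mul_eq {x p : A} (hp : IsStarProjection p) (h : p * x = x) :
    lp x * p = lp x := by
  rw [← star_lp, ← hp.isSelfAdjoint.star_eq, ← star_mul, mul_lp_eq_of_mul_eq h]

end LeftProjection

section Domination

variable {A : Type*} [Ring A]

/-- There is an element that maps `C` injectively into `B`. -/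
def Dom (C B : A) : Prop := ∃ x : A, x * C = x ∧ B * x = x ∧ ∀ z, x * z = 0 → C * z = 0

lemma Dom.of_le {C B : A} (hC : C * C = C) (h : B * C = C) : Dom C B :=
  ⟨C, hC, h, fun _ hz => hz⟩

lemma Dom.trans {C B D : A} (h₁ : Dom C B) (h₂ : Dom B D) : Dom C D := by
  obtain ⟨x, hxC, hBx, hx⟩ := h₁
  obtain ⟨y, hyB, hDy, hy⟩ := h₂
  refine ⟨y * x, by rw [mul_assoc, hxC], by rw [← mul_assoc, hDy], fun z hz => hx z ?_⟩
  rw [← hBx, mul_assoc]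
  exact hy _ (by rw [← mul_assoc, hz])

end Domination

section Orthogonal

lemma eq_zero_of_star_mul_self_mul {A : Type*} [NonUnitalCStarAlgebra A] {x z : A}
    (h : star x * x * z = 0) : x * z = 0 := by
  rw [← CStarRing.star_mul_self_eq_zero_iff, star_mul, mul_assoc, ← mul_assoc (star x), h,
    mul_zero]

variable {A : Type*} [CStarAlgebra A] [PartialOrder A] [StarOrderedRing A]

lemma abs_mul_eq_zero_iff {x z : A} : CFC.abs x * z = 0 ↔ x * z = 0 := by
  have h1 : star (CFC.abs x) * CFC.abs x = star x * x := by
    rw [(CFC.abs_nonneg x).isSelfAdjoint.star_eq, CFC.abs_mul_abs]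
  constructor <;> intro h <;> apply eq_zero_of_star_mul_self_mul
  · rw [← h1, mul_assoc, h, mul_zero]
  · rw [h1, mul_assoc, h, mul_zero]

lemma Dom.exists_partialIsometry [IsRickart A] {C B : A} (hC : IsStarProjection C)
    (h : Dom C B) (hBC : C * B = 0) : ∃ u : A, star u * u = C ∧ B * u = u := by
  obtain ⟨x, hxC, hBx, hx⟩ := h
  have hCs : star C = C := hC.isSelfAdjoint
  have hCC : C * C = C := hC.isIdempotentElem
  set k := CFC.abs x with hk
  have hks : star k = k := (CFC.abs_nonneg x).isSelfAdjoint
  have hkk : k * k = star x * x := CFC.abs_mul_abs x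
  have hkC : k * C = k := by
    have : k * (1 - C) = 0 := abs_mul_eq_zero_iff.2 (by rw [mul_sub, hxC]; simp)
    rw [mul_sub, mul_one, sub_eq_zero] at this
    exact this.symm
  have hCk : C * k = k := by rw [← hks, ← hCs, ← star_mul, hkC]
  have hCx : C * x = 0 := by rw [← hBx, ← mul_assoc, hBC, zero_mul]
  have hkx : k * x = 0 := by rw [← hkC, mul_assoc, hCx, mul_zero]
  have hinj (w : A) (hw : w * k = 0) : w * C = 0 := by
    have h1 : k * star w = 0 := by rw [← hks, ← star_mul, hw, star_zero]
    have h2 := hx _ (abs_mul_eq_zero_iff.1 h1)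
    rw [← star_star w, ← hCs, ← star_mul, h2, star_zero]
  have hxk : star x * k = 0 := by rw [← hks, ← star_mul, hkx, star_zero]
  set P := lp (k + x) with hP
  have hPs : star P = P := star_lp _
  have hPP : P * P = P := lp_mul_lp _
  have h1 : P * (k + x) = k + x := lp_mul _
  have h2 : P * (k - x) = 0 := by
    apply lp_mul_eq_zero
    rw [star_add, hks, add_mul, mul_sub, mul_sub, hkk, hkx, hxk]
    simp
  have h3 : 2 * (P * k) = k + x := by linear_combination (norm := noncomm_ring) h1 + h2
  have h4 : 2 * (C * P * C) = C := by
    have := hinj (2 * (C * P) - C) (by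
      linear_combination (norm := noncomm_ring) C * h3 + hCx)
    linear_combination (norm := noncomm_ring) this + hCC
  refine ⟨2 * ((1 - C) * P * C), ?_, ?_⟩
  · rw [star_mul, star_mul, star_mul, star_sub, star_one, hCs, hPs]
    have h2s : star (2 : A) = 2 := by simp
    rw [h2s]
    have e1 : C * (P * (1 - C)) * 2 * (2 * ((1 - C) * P * C))
      = 4 * (C * P * (1 - C) * P * C) := by
      linear_combination (norm := noncomm_ring) 4 * (C * P) * hCC * (P * C)
    rw [e1]
    linear_combination (norm := noncomm_ring) 4 * C * hPP * C + 2 * h4 - (2 * C * P * C) * h4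
      - h4 * C + 4 * C * P * hCC * (P * C) - hCC
  · have h5 := hinj (2 * (B * ((1 - C) * P)) - 2 * ((1 - C) * P)) (by
      linear_combination (norm := noncomm_ring) B * (1 - C) * h3 - (1 - C) * h3
        - B * hCk + hCk - B * hCx + hCx + hBx)
    linear_combination (norm := noncomm_ring) h5

end Orthogonal

section WeightedSum

variable {A : Type*} [CStarAlgebra A]

/-- The dyadically weighted sum of a sequence. -/
noncomputable def wsum (x : ℕ → A) : A := ∑' k, (1 / 2 : ℝ) ^ k • x k

lemma summable_wsum {x : ℕ → A} {M : ℝ} (hx : ∀ k, ‖x k‖ ≤ M) :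
    Summable fun k => (1 / 2 : ℝ) ^ k • x k := by
  refine Summable.of_norm_bounded (summable_geometric_two.mul_right M) fun k => ?_
  rw [norm_smul, norm_pow, Real.norm_of_nonneg (by norm_num : (0 : ℝ) ≤ 1 / 2)]
  gcongr
  exact hx k

lemma mul_wsum {x : ℕ → A} {M : ℝ} (hx : ∀ k, ‖x k‖ ≤ M) (a : A) :
    a * wsum x = wsum fun k => a * x k := by
  simp only [wsum, ← (summable_wsum hx).tsum_mul_left, mul_smul_comm]

lemma wsum_mul {x : ℕ → A} {M : ℝ} (hx : ∀ k, ‖x k‖ ≤ M) (a : A) :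
    wsum x * a = wsum fun k => x k * a := by
  simp only [wsum, ← (summable_wsum hx).tsum_mul_right, smul_mul_assoc]

lemma wsum_single {x : ℕ → A} (j : ℕ) (hx : ∀ k, k ≠ j → x k = 0) :
    wsum x = (1 / 2 : ℝ) ^ j • x j :=
  tsum_eq_single j fun k hk => by rw [hx k hk, smul_zero]

lemma wsum_zero : wsum (fun _ => (0 : A)) = 0 := by simp [wsum]

lemma wsum_mul_eq_zero_iff {x : ℕ → A} {M : ℝ} (hx : ∀ k, ‖x k‖ ≤ M) {q : ℕ → A}
    (hqx : ∀ k, q k * x k = x k) (hq : ∀ j k, k ≠ j → q j * x k = 0) {z : A} :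
    wsum x * z = 0 ↔ ∀ k, x k * z = 0 := by
  constructor
  · intro h k
    have h1 : q k * wsum x = (1 / 2 : ℝ) ^ k • x k := by
      rw [mul_wsum hx, wsum_single k (hq k), hqx]
    have h2 : (1 / 2 : ℝ) ^ k • (x k * z) = 0 := by
      rw [← smul_mul_assoc, ← h1, mul_assoc, h, mul_zero]
    exact (smul_eq_zero.1 h2).resolve_left (by positivity)
  · intro h
    rw [wsum_mul hx]
    simp only [h, wsum_zero]

end WeightedSum

section Frames

variable {A : Type*} [CStarAlgebra A]

/-- A sequence of pairwise orthogonal projections. -/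
structure IsFrame (e : ℕ → A) : Prop where
  proj : ∀ i, IsStarProjection (e i)
  orth : ∀ i j, i ≠ j → e i * e j = 0

/-- The partial sums of a sequence. -/
def psum (e : ℕ → A) (n : ℕ) : A := ∑ k ∈ Finset.range n, e k

@[simp] lemma psum_zero (e : ℕ → A) : psum e 0 = 0 := rfl

lemma psum_succ (e : ℕ → A) (n : ℕ) : psum e (n + 1) = psum e n + e n :=
  Finset.sum_range_succ _ _

lemma psum_add (p q : ℕ → A) (n : ℕ) : psum (p + q) n = psum p n + psum q n :=
  Finset.sum_add_distrib

namespace IsFrame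

variable {e : ℕ → A} (he : IsFrame e)
include he

lemma sq (i : ℕ) : e i * e i = e i := (he.proj i).isIdempotentElem

lemma star_eq (i : ℕ) : star (e i) = e i := (he.proj i).isSelfAdjoint

lemma norm_le (i : ℕ) : ‖e i‖ ≤ 1 := (he.proj i).norm_le

lemma mul_psum (k n : ℕ) : e k * psum e n = if k < n then e k else 0 := by
  induction n with
  | zero => simp
  | succ n ih =>
    rw [psum_succ, mul_add, ih]
    rcases lt_trichotomy k n with h | rfl | h
    · simp [h, he.orth k n h.ne, h.trans (Nat.lt_succ_self n)]
    · simp [he.sq]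
    · simp [he.orth k n h.ne', not_lt.2 h.le, not_lt.2 (Nat.succ_le_of_lt h)]

lemma isSelfAdjoint_psum (n : ℕ) : star (psum e n) = psum e n := by
  simp [psum, star_sum, he.star_eq]

lemma psum_mul (k n : ℕ) : psum e n * e k = if k < n then e k else 0 := by
  have := congrArg star (he.mul_psum k n)
  rw [star_mul, he.star_eq, he.isSelfAdjoint_psum] at this
  rw [this]
  split_ifs <;> simp [he.star_eq]

lemma psum_mul_psum {m n : ℕ} (h : m ≤ n) : psum e m * psum e n = psum e m := by
  induction m with
  | zero => simp
  | succ m ih => rw [psum_succ, add_mul, ih (by omega), he.mul_psum, if_pos (by omega)]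

lemma isStarProjection_psum (n : ℕ) : IsStarProjection (psum e n) :=
  ⟨he.psum_mul_psum le_rfl, he.isSelfAdjoint_psum n⟩

lemma psum_mul_wsum (n : ℕ) :
    psum e n * wsum e = ∑ k ∈ Finset.range n, (1 / 2 : ℝ) ^ k • e k := by
  rw [psum, Finset.sum_mul]
  refine Finset.sum_congr rfl fun k _ => ?_
  rw [mul_wsum he.norm_le, wsum_single k fun j hj => he.orth k j hj.symm, he.sq]

lemma tendsto_psum_mul_wsum :
    Filter.Tendsto (fun n => psum e n * wsum e) Filter.atTop (nhds (wsum e)) := by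
  simp only [he.psum_mul_wsum]
  exact (summable_wsum he.norm_le).hasSum.tendsto_sum_nat

lemma star_wsum : star (wsum e) = wsum e := by
  rw [wsum, tsum_star]
  simp [he.star_eq]

lemma add {q : ℕ → A} (hq : IsFrame q) (h : ∀ i j, e i * q j = 0) (h' : ∀ i j, q i * e j = 0) :
    IsFrame (e + q) where
  proj i := by
    refine ⟨?_, ?_⟩
    · simp [IsIdempotentElem, mul_add, add_mul, h, h', he.sq, hq.sq]
    · simp [IsSelfAdjoint, he.star_eq, hq.star_eq]
  orth i j hij := by simp [mul_add, add_mul, h, h', he.orth i j hij, hq.orth i j hij]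

end IsFrame

/-- The supremum of a frame. -/
noncomputable def fsup [IsRickart A] (e : ℕ → A) : A := lp (wsum e)

variable [IsRickart A]

lemma isStarProjection_fsup (e : ℕ → A) : IsStarProjection (fsup e) := isStarProjection_lp _

lemma star_fsup (e : ℕ → A) : star (fsup e) = fsup e := star_lp _

lemma fsup_mul_fsup (e : ℕ → A) : fsup e * fsup e = fsup e := lp_mul_lp _

namespace IsFrame

variable {e : ℕ → A} (he : IsFrame e)
include he

lemma fsup_mul (k : ℕ) : fsup e * e k = e k := by
  have h : fsup e * ((1 / 2 : ℝ) ^ k • e k) = (1 / 2 : ℝ) ^ k • e k := by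
    have h1 : wsum e * e k = (1 / 2 : ℝ) ^ k • e k := by
      rw [wsum_mul he.norm_le, wsum_single k fun j hj => he.orth j k hj, he.sq]
    rw [← h1, ← mul_assoc, fsup, lp_mul]
  rw [mul_smul_comm] at h
  exact smul_right_injective A (by positivity : ((1 / 2 : ℝ) ^ k) ≠ 0) h

lemma mul_fsup (k : ℕ) : e k * fsup e = e k := by
  rw [← he.star_eq, ← star_fsup, ← star_mul, he.fsup_mul]

lemma psum_mul_fsup (n : ℕ) : psum e n * fsup e = psum e n := by
  simp [psum, Finset.sum_mul, he.mul_fsup]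

lemma mul_fsup_eq_zero {y : A} (h : ∀ k, y * e k = 0) : y * fsup e = 0 := by
  apply mul_lp
  rw [mul_wsum he.norm_le]
  simp only [h, wsum_zero]

lemma fsup_mul_eq_zero {y : A} (h : ∀ k, e k * y = 0) : fsup e * y = 0 := by
  rw [← star_star y, ← star_fsup, ← star_mul, he.mul_fsup_eq_zero, star_zero]
  intro k
  rw [← he.star_eq, ← star_mul, h, star_zero]

lemma mul_fsup_eq {y : A} (h : ∀ k, y * e k = e k) : y * fsup e = fsup e := by
  have := he.mul_fsup_eq_zero (y := y - 1) fun k => by rw [sub_mul, h, one_mul, sub_self]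
  rwa [sub_mul, one_mul, sub_eq_zero] at this

lemma fsup_add {q : ℕ → A} (hq : IsFrame q) (h : ∀ i j, e i * q j = 0)
    (h' : ∀ i j, q i * e j = 0) : fsup (e + q) = fsup e + fsup q := by
  have hf := he.add hq h h'
  have h1 : fsup (e + q) * fsup e = fsup e := he.mul_fsup_eq fun k => by
    have := congrArg (· * e k) (hf.fsup_mul k)
    simpa [mul_assoc, add_mul, h', he.sq] using this
  have h2 : fsup (e + q) * fsup q = fsup q := hq.mul_fsup_eq fun k => by
    have := congrArg (· * q k) (hf.fsup_mul k)
    simpa [mul_assoc, add_mul, h, hq.sq] using this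
  have h3 : (fsup e + fsup q) * fsup (e + q) = fsup (e + q) := hf.mul_fsup_eq fun k => by
    simp [add_mul, mul_add, he.fsup_mul, hq.fsup_mul, he.fsup_mul_eq_zero fun i => h i k,
      hq.fsup_mul_eq_zero fun i => h' i k]
  have h4 := congrArg star h3
  simp only [star_mul, star_add, star_fsup] at h4
  rw [← h4, mul_add, h1, h2]

end IsFrame

end Frames

section Normality

variable {A : Type*} [CStarAlgebra A] [PartialOrder A] [StarOrderedRing A] [IsRickart A]

/-- Compressed bounds on the partial sums of the frame pass to its supremum. -/
def IsNormalFrame (e : ℕ → A) : Prop :=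
  ∀ y D : A, (∀ n, y * psum e n * star y ≤ D) → y * fsup e * star y ≤ D

omit [IsRickart A] in
lemma mul_proj_mul_star_le_one_iff {y p : A} (hp : IsStarProjection p) :
    y * p * star y ≤ 1 ↔ ‖y * p‖ ≤ 1 := by
  have h1 : y * p * star y = (y * p) * star (y * p) := by
    rw [star_mul, hp.isSelfAdjoint.star_eq, mul_assoc, mul_assoc, ← mul_assoc p p,
      hp.isIdempotentElem.eq]
  rw [h1, ← CStarAlgebra.norm_le_one_iff_of_nonneg _ (mul_star_self_nonneg _),
    CStarRing.norm_self_mul_star]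
  constructor <;> intro h <;> nlinarith [norm_nonneg (y * p)]

omit [IsRickart A] in
lemma conj_le_conj {a b : A} (h : a ≤ b) (c : A) : c * a * star c ≤ c * b * star c :=
  star_right_conjugate_le_conjugate h c

omit [IsRickart A] in
lemma conj_le_conj' {a b : A} (h : a ≤ b) (c : A) : star c * a * c ≤ star c * b * c :=
  star_left_conjugate_le_conjugate h c

omit [IsRickart A] in
lemma le_of_forall_pos_le_add_smul {a D : A} (h : ∀ ε : ℝ, 0 < ε → a ≤ D + ε • (1 : A)) :
    a ≤ D := by
  have hlim : Filter.Tendsto (fun ε : ℝ => D + ε • (1 : A)) (nhdsWithin 0 (Set.Ioi 0))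
      (nhds (D + (0 : ℝ) • (1 : A))) :=
    (tendsto_const_nhds.add (Filter.tendsto_id.smul_const (1 : A))).mono_left nhdsWithin_le_nhds
  rw [zero_smul, add_zero] at hlim
  have : ClosedIciTopology A := inferInstance
  exact ge_of_tendsto hlim (eventually_nhdsWithin_of_forall fun ε hε => h ε hε)

lemma isNormalFrame_of_norm {e : ℕ → A} (he : IsFrame e)
    (h : ∀ y, (∀ n, ‖y * psum e n‖ ≤ 1) → ‖y * fsup e‖ ≤ 1) : IsNormalFrame e := by
  intro y D hD
  have hD0 : 0 ≤ D := by simpa using hD 0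
  refine le_of_forall_pos_le_add_smul fun ε hε => ?_
  set d := D + ε • (1 : A) with hd
  have hDd : D ≤ d := le_add_of_nonneg_right (smul_nonneg hε.le zero_le_one)
  have hdpos : IsStrictlyPositive d := by
    refine IsStrictlyPositive.nonneg_add hD0 ?_
    exact IsStrictlyPositive.smul hε isStrictlyPositive_one
  set r := d ^ (-(1 / 2) : ℝ) with hr
  have hrd : r * d * r = 1 := CFC.conjugate_rpow_neg_one_half d hdpos
  have hrs : star r = r := (CFC.rpow_nonneg : 0 ≤ r).isSelfAdjoint
  have hcomm : r * d = d * r := by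
    calc r * d = r * d * (r * d * r) := by rw [hrd, mul_one]
      _ = (r * d * r) * (d * r) := by simp only [mul_assoc]
      _ = d * r := by rw [hrd, one_mul]
  obtain ⟨s, hsr, hss⟩ : ∃ s : A, s * r = 1 ∧ star s = s :=
    ⟨d * r, by rw [← hcomm, hrd], by
      rw [star_mul, hrs, hdpos.nonneg.isSelfAdjoint.star_eq, hcomm]⟩
  have hrs' : r * s = 1 := by rw [← hrs, ← hss, ← star_mul, hsr, star_one]
  have h1 : ‖r * y * fsup e‖ ≤ 1 := h _ fun n => by
    rw [← mul_proj_mul_star_le_one_iff (he.isStarProjection_psum n), ← hrd]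
    calc r * y * psum e n * star (r * y) = r * (y * psum e n * star y) * star r := by
          simp only [star_mul, mul_assoc]
      _ ≤ r * d * star r := conj_le_conj ((hD n).trans hDd) r
      _ = r * d * r := by rw [hrs]
  rw [← mul_proj_mul_star_le_one_iff (isStarProjection_fsup e)] at h1
  have h2 := conj_le_conj h1 s
  have h3 : s * (r * y * fsup e * star (r * y)) * star s = y * fsup e * star y := by
    calc _ = (s * r) * (y * fsup e * star y) * (r * s) := by
          simp only [star_mul, mul_assoc, hrs, hss]
      _ = _ := by rw [hsr, hrs', one_mul, mul_one]
  have h4 : s * 1 * star s = d := by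
    rw [hss]
    calc s * 1 * s = s * (r * d * r) * s := by rw [hrd]
      _ = (s * r) * d * (r * s) := by simp only [mul_assoc]
      _ = d := by rw [hsr, hrs', one_mul, mul_one]
  rwa [h3, h4] at h2

omit [StarOrderedRing A] in
lemma isNormalFrame_of_eventually_zero {e : ℕ → A} (he : IsFrame e) (N : ℕ)
    (h : ∀ n, N ≤ n → e n = 0) : IsNormalFrame e := by
  have : fsup e = psum e N := by
    have h1 : psum e N * fsup e = fsup e := he.mul_fsup_eq fun k => by
      rw [he.psum_mul]
      split_ifs with hk
      · rfl
      · rw [h k (not_lt.1 hk)]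
    rw [← h1, he.psum_mul_fsup]
  intro y D hD
  rw [this]
  exact hD N

lemma IsNormalFrame.add {p q : ℕ → A} (hp : IsFrame p) (hq : IsFrame q)
    (h : ∀ i j, p i * q j = 0) (h' : ∀ i j, q i * p j = 0)
    (hpn : IsNormalFrame p) (hqn : IsNormalFrame q) : IsNormalFrame (p + q) := by
  intro y D hD
  have hmono {e : ℕ → A} (he : IsFrame e) {m n : ℕ} (hmn : m ≤ n) : psum e m ≤ psum e n :=
    Finset.sum_le_sum_of_subset_of_nonneg (Finset.range_mono hmn) fun i _ _ => (he.proj i).nonneg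
  have h1 (n m : ℕ) : y * psum p n * star y + y * psum q m * star y ≤ D := by
    refine le_trans ?_ (hD (max n m))
    rw [psum_add, mul_add, add_mul]
    exact add_le_add (conj_le_conj (hmono hp (le_max_left _ _)) y)
      (conj_le_conj (hmono hq (le_max_right _ _)) y)
  have h2 (m : ℕ) : y * fsup p * star y ≤ D - y * psum q m * star y :=
    hpn y _ fun n => le_sub_iff_add_le.2 (h1 n m)
  have h3 : y * fsup q * star y ≤ D - y * fsup p * star y :=
    hqn y _ fun m => le_sub_comm.1 (h2 m)
  rw [hp.fsup_add hq h h', mul_add, add_mul, add_comm]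
  exact le_sub_iff_add_le.1 h3

lemma IsNormalFrame.eq_zero {c : ℕ → A} (hc : IsNormalFrame c) {t x : A}
    (ht : IsStarProjection t) {θ : ℝ} (hθ : θ < 1) (h : ∀ n, t * psum c n * t ≤ θ • (1 : A))
    (htx : t * x = x) (hcx : fsup c * x = x) : x = 0 := by
  have hts : star t = t := ht.isSelfAdjoint
  have h1 : t * fsup c * star t ≤ θ • (1 : A) := hc t _ fun n => by rw [hts]; exact h n
  have h2 := conj_le_conj' h1 x
  have h3 : star x * (t * fsup c * star t) * x = star x * x := by
    rw [hts]
    simp only [mul_assoc, htx, hcx]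
  have h4 : star x * (θ • (1 : A)) * x = θ • (star x * x) := by simp
  rw [h3, h4] at h2
  have h5 : (1 - θ) • (star x * x) ≤ 0 := by
    rw [sub_smul, one_smul]
    exact sub_nonpos.2 h2
  have h6 : (0 : A) ≤ (1 - θ) • (star x * x) :=
    smul_nonneg (by linarith) (star_mul_self_nonneg x)
  have h7 := (smul_eq_zero.1 (le_antisymm h5 h6)).resolve_left (by linarith)
  exact (CStarRing.star_mul_self_eq_zero_iff x).1 h7

lemma isNormalFrame_of_dom {e : ℕ → A} (he : IsFrame e) {B B' : A} (hB : IsStarProjection B)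
    (hBB' : B * B' = 0) (hCB : fsup e * B = 0)
    (hCB' : fsup e * B' = 0) (h : Dom (fsup e) B) (h' : Dom (fsup e) B') : IsNormalFrame e := by
  obtain ⟨v, hv, hBv⟩ := h.exists_partialIsometry (isStarProjection_fsup e) hCB
  obtain ⟨w, hw, hBw⟩ := h'.exists_partialIsometry (isStarProjection_fsup e) hCB'
  refine isNormalFrame_of_norm he fun y hy => ?_
  set C := fsup e with hC
  have hCs : star C = C := star_fsup e
  have hCC : C * C = C := fsup_mul_fsup e
  have hBs : star B = B := hB.isSelfAdjoint
  set k := wsum e with hk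
  have hks : star k = k := he.star_wsum
  have hCk : C * k = k := lp_mul _
  have hkC : k * C = k := by rw [← hks, ← hCs, ← star_mul, hCk]
  set a := CFC.abs (y * C) with ha
  have has : star a = a := (CFC.abs_nonneg _).isSelfAdjoint
  have haa : a * a = star (y * C) * (y * C) := CFC.abs_mul_abs _
  have haC : a * C = a := by
    have : a * (1 - C) = 0 := abs_mul_eq_zero_iff.2 (by
      rw [mul_sub, mul_assoc y C C, hCC, mul_one, sub_self])
    rw [mul_sub, mul_one, sub_eq_zero] at this
    exact this.symm
  have hCa : C * a = a := by rw [← has, ← hCs, ← star_mul, haC]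
  have hle : k * (a * a) * k ≤ k * k := by
    have h1 (n : ℕ) : star (psum e n * k) * (a * a) * (psum e n * k) ≤ k * k := by
      have h2 : star (y * psum e n) * (y * psum e n) ≤ 1 := by
        rw [← CStarAlgebra.norm_le_one_iff_of_nonneg _ (star_mul_self_nonneg _),
          CStarRing.norm_star_mul_self]
        nlinarith [hy n, norm_nonneg (y * psum e n)]
      have h3 := conj_le_conj' h2 k
      rw [mul_one, hks] at h3
      refine le_of_eq_of_le ?_ h3
      rw [haa]
      have h4 : C * (psum e n * k) = psum e n * k := by
        rw [← mul_assoc, ← hCs, ← he.isSelfAdjoint_psum, ← star_mul, he.psum_mul_fsup]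
      calc _ = star (C * (psum e n * k)) * (star y * y) * (C * (psum e n * k)) := by
            simp only [star_mul, mul_assoc]
        _ = _ := by rw [h4]; simp only [star_mul, mul_assoc, hks]
    have h2 := he.tendsto_psum_mul_wsum
    have h3 := (h2.star.mul_const (a * a)).mul h2
    have h4 := le_of_tendsto h3 (Filter.Eventually.of_forall h1)
    rwa [← hk, hks] at h4
  set b := CFC.sqrt (k * k - k * (a * a) * k) with hb
  have hbs : star b = b := (CFC.sqrt_nonneg _).isSelfAdjoint
  have hbb : b * b = k * k - k * (a * a) * k := CFC.sqrt_mul_sqrt_self _ (sub_nonneg.2 hle)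
  have hbC : b * C = b := by
    have : b * (1 - C) = 0 := eq_zero_of_star_mul_self_mul (by
      rw [hbs, hbb]
      linear_combination (norm := noncomm_ring) -k * hkC + k * a * a * hkC)
    rw [mul_sub, mul_one, sub_eq_zero] at this
    exact this.symm
  have hCB0 : C * B = 0 := hCB
  have hvw : star v * w = 0 := by
    rw [← hBv, ← hBw, star_mul, hBs, mul_assoc, ← mul_assoc B, hBB', zero_mul, mul_zero]
  have hwv : star w * v = 0 := by rw [← star_star v, ← star_mul, hvw, star_zero]
  set X := v * a * k + w * b with hX
  have hXX : star X * X = k * k := by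
    simp only [hX, star_add, star_mul, has, hbs, hks]
    linear_combination (norm := noncomm_ring) k * a * hv * a * k + k * a * hvw * b
      + b * hwv * a * k + b * hw * b + hbC * b + k * a * hCa * k + hbb
  have hCv : C * v = 0 := by rw [← hBv, ← mul_assoc, hCB, zero_mul]
  have hCw : C * w = 0 := by rw [← hBw, ← mul_assoc, hCB', zero_mul]
  have hkX : k * X = 0 := by
    linear_combination (norm := noncomm_ring) -hkC * X + k * C * hX + k * hCv * a * k + k * hCw * b
  have hXk : star X * k = 0 := by rw [← hks, ← star_mul, hkX, star_zero]
  have hBC : B * C = 0 := by rw [← hBs, ← hCs, ← star_mul, hCB, star_zero]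
  set P := lp (k + X) with hP
  have hPs : star P = P := star_lp _
  have hPP : P * P = P := lp_mul_lp _
  have h1 : P * (k + X) = k + X := lp_mul _
  have h2 : P * (k - X) = 0 := by
    apply lp_mul_eq_zero
    rw [star_add, hks]
    linear_combination (norm := noncomm_ring) hXk - hkX - hXX
  have h3 : 2 * (P * k) = k + X := by linear_combination (norm := noncomm_ring) h1 + h2
  have hBw0 : B * w = 0 := by rw [← hBw, ← mul_assoc, hBB', zero_mul]
  have h4 : (2 * (B * P) - v * a) * C = 0 := mul_lp (by
    rw [← hk]
    linear_combination (norm := noncomm_ring) B * h3 + B * hX + hBC * k - B * hCk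
      + hBv * a * k + hBw0 * b)
  have h5 : v * a = 2 * (B * P * C) := by
    linear_combination (norm := noncomm_ring) v * haC.symm - h4
  have h6 : a * a = 4 * (C * P * B * P * C) := by
    have : star (v * a) * (v * a) = a * a := by
      rw [star_mul, has]
      linear_combination (norm := noncomm_ring) a * hv * a + haC * a
    rw [← this, h5]
    simp only [star_mul, hCs, hPs, hBs, star_ofNat]
    linear_combination (norm := noncomm_ring) 4 * C * P * hB.isIdempotentElem.eq * P * C
  have h7 : B ≤ 1 - C := hB.le_of_mul_eq_left (isStarProjection_fsup e).one_sub (by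
    rw [mul_sub, hBC, mul_one, sub_zero])
  have h8 : star (P * C) * B * (P * C) ≤ star (P * C) * (1 - C) * (P * C) := conj_le_conj' h7 _
  have h9 : a * a ≤ 1 := by
    have four_smul (z : A) : (4 : ℝ) • z = 4 * z := by rw [Algebra.smul_def, map_ofNat]
    have h10 : 0 ≤ star (1 - 2 * (C * P * C)) * (1 - 2 * (C * P * C)) := star_mul_self_nonneg _
    have h11 : a * a = (4 : ℝ) • (star (P * C) * B * (P * C)) := by
      rw [h6, star_mul, hPs, hCs, four_smul]
      noncomm_ring
    have h12 : 1 - (4 : ℝ) • (star (P * C) * (1 - C) * (P * C)) =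
        star (1 - 2 * (C * P * C)) * (1 - 2 * (C * P * C)) := by
      simp only [star_sub, star_one, star_mul, star_ofNat, hPs, hCs, four_smul]
      linear_combination (norm := noncomm_ring) -4 * C * hPP * C
        - 4 * C * P * hCC * P * C
    rw [h11]
    refine (smul_le_smul_of_nonneg_left h8 (by norm_num)).trans ?_
    rw [← sub_nonneg, h12]
    exact h10
  rw [haa, ← CStarAlgebra.norm_le_one_iff_of_nonneg _ (star_mul_self_nonneg _),
    CStarRing.norm_star_mul_self] at h9
  nlinarith [norm_nonneg (y * C)]

end Normality

lemma mul_eq_of_mul_eq {A : Type*} [Mul A] [StarMul A] {a p : A} (ha : star a = a)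
    (hp : star p = p) (h : p * a = a) : a * p = a := by
  rw [← ha, ← hp, ← star_mul, h]

lemma mul_eq_zero_of_le {A : Type*} [Ring A] [StarRing A] {a b p q : A}
    (ha : star a = a) (hp : star p = p) (hpa : p * a = a) (hqb : q * b = b) (hpq : p * q = 0) :
    a * b = 0 := by
  rw [← mul_eq_of_mul_eq ha hp hpa, ← hqb, mul_assoc, ← mul_assoc p, hpq, zero_mul, mul_zero]

lemma mul_eq_zero_symm {A : Type*} [Ring A] [StarRing A] {a b : A} (ha : star a = a)
    (hb : star b = b) (h : a * b = 0) : b * a = 0 := by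
  rw [← ha, ← hb, ← star_mul, h, star_zero]

lemma isStarProjection_sub {A : Type*} [Ring A] [StarRing A] {p q : A}
    (hp : IsStarProjection p) (hq : IsStarProjection q) (h : p * q = q) :
    IsStarProjection (p - q) := by
  have h' : q * p = q := mul_eq_of_mul_eq hq.isSelfAdjoint hp.isSelfAdjoint h
  refine ⟨?_, hp.isSelfAdjoint.sub hq.isSelfAdjoint⟩
  rw [IsIdempotentElem, mul_sub, sub_mul, sub_mul, h, h', hp.isIdempotentElem.eq,
    hq.isIdempotentElem.eq, sub_self, sub_zero]

section

variable {A : Type*} [CStarAlgebra A]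

lemma IsFrame.of_le {g c : ℕ → A} (hg : IsFrame g) (hc : ∀ i, IsStarProjection (c i))
    (h : ∀ i, g i * c i = c i) : IsFrame c where
  proj := hc
  orth i j hij :=
    mul_eq_zero_of_le (hc i).isSelfAdjoint (hg.star_eq i) (h i) (h j) (hg.orth i j hij)

lemma Dom.exists_norm_le_one {C B : A} (h : Dom C B) :
    ∃ x : A, ‖x‖ ≤ 1 ∧ x * C = x ∧ B * x = x ∧ ∀ z, x * z = 0 → C * z = 0 := by
  obtain ⟨x, hxC, hBx, hx⟩ := h
  have hpos : 0 < ‖x‖ + 1 := by positivity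
  refine ⟨(‖x‖ + 1)⁻¹ • x, ?_, by rw [smul_mul_assoc, hxC], by rw [mul_smul_comm, hBx], ?_⟩
  · rw [norm_smul, norm_inv, Real.norm_of_nonneg hpos.le, inv_mul_le_one₀ hpos]
    linarith
  · intro z hz
    rw [smul_mul_assoc] at hz
    exact hx z ((smul_eq_zero.1 hz).resolve_left (by positivity))

variable [IsRickart A]

lemma Dom.fsup {p q : ℕ → A} (hp : IsFrame p) (hq : IsFrame q) (h : ∀ i, Dom (p i) (q i)) :
    Dom (fsup p) (fsup q) := by
  choose x hx1 hxp hqx hx using fun i => (h i).exists_norm_le_one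
  refine ⟨wsum x, ?_, ?_, fun z hz => hp.fsup_mul_eq_zero fun i => hx i z ?_⟩
  · rw [wsum_mul hx1]
    congr 1
    ext i
    rw [← hxp i, mul_assoc, hp.mul_fsup]
  · rw [mul_wsum hx1]
    congr 1
    ext i
    rw [← hqx i, ← mul_assoc, hq.fsup_mul]
  · refine (wsum_mul_eq_zero_iff hx1 hqx (fun j k hjk => ?_)).1 hz i
    rw [← hqx k, ← mul_assoc, hq.orth j k hjk.symm, zero_mul]

/-- What remains of the projection `t` after successively removing the parts seen by the
members of `g`. -/
noncomputable def residue (g : ℕ → A) (t : A) : ℕ → A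
  | 0 => t
  | n + 1 => residue g t n - lp (residue g t n * g n)

section Residue

variable {g : ℕ → A} {t : A} (ht : IsStarProjection t)

lemma residue_succ (n : ℕ) :
    residue g t (n + 1) = residue g t n - lp (residue g t n * g n) := rfl

include ht

lemma isStarProjection_residue (n : ℕ) : IsStarProjection (residue g t n) := by
  induction n with
  | zero => exact ht
  | succ n ih =>
    refine isStarProjection_sub ih (isStarProjection_lp _) (mul_lp_eq_of_mul_eq ?_)
    rw [← mul_assoc, ih.isIdempotentElem.eq]

lemma residue_mul_lp (n : ℕ) :
    residue g t n * lp (residue g t n * g n) = lp (residue g t n * g n) :=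
  mul_lp_eq_of_mul_eq (by
    rw [← mul_assoc, (isStarProjection_residue ht n).isIdempotentElem.eq])

lemma residue_mul_residue {m n : ℕ} (h : m ≤ n) :
    residue g t m * residue g t n = residue g t n := by
  induction n, h using Nat.le_induction with
  | base => exact (isStarProjection_residue ht m).isIdempotentElem.eq
  | succ n _ ih =>
    rw [residue_succ, mul_sub, ih, ← residue_mul_lp ht n, ← mul_assoc, ih]

lemma residue_succ_mul (n : ℕ) : residue g t (n + 1) * g n = 0 := by
  have hs := (isStarProjection_residue (g := g) ht n).isSelfAdjoint.star_eq
  have h1 : lp (residue g t n * g n) * residue g t n = lp (residue g t n * g n) :=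
    mul_eq_of_mul_eq (star_lp _) hs (residue_mul_lp ht n)
  rw [residue_succ, sub_mul, ← h1, mul_assoc, lp_mul, sub_self]

lemma residue_succ_mul_lp (n : ℕ) :
    residue g t (n + 1) * lp (residue g t n * g n) = 0 := by
  rw [residue_succ, sub_mul, residue_mul_lp ht, lp_mul_lp, sub_self]

end Residue

/-- A frame that separates the range of a projection contains a subframe whose supremum is
equivalent to this projection. -/
lemma exists_frame_dom {g : ℕ → A} {t : A} (hg : IsFrame g) (ht : IsStarProjection t)
    (h : ∀ x, t * x = x → (∀ i, g i * x = 0) → x = 0) :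
    ∃ c : ℕ → A, IsFrame c ∧ (∀ i, g i * c i = c i) ∧ Dom (fsup c) t ∧ Dom t (fsup c) := by
  set r := residue g t with hr
  have hrp (i) : IsStarProjection (r i) := isStarProjection_residue ht i
  have hrs (i) : star (r i) = r i := (hrp i).isSelfAdjoint
  set u : ℕ → A := fun i => g i * r i with hu
  have hu1 (i) : ‖u i‖ ≤ 1 :=
    (norm_mul_le _ _).trans (mul_le_one₀ (hg.norm_le i) (norm_nonneg _) (hrp i).norm_le)
  have hgu (i) : g i * u i = u i := by rw [hu, ← mul_assoc, hg.sq]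
  have hgc (i) : g i * lp (u i) = lp (u i) := mul_lp_eq_of_mul_eq (hgu i)
  have hc : IsFrame fun i => lp (u i) := hg.of_le (fun i => isStarProjection_lp _) hgc
  have htr (i) : t * r i = r i := residue_mul_residue ht (Nat.zero_le i)
  have hUt : wsum u * t = wsum u := by
    rw [wsum_mul hu1]
    congr 1
    ext i
    rw [hu, mul_assoc, mul_eq_of_mul_eq (hrs i) ht.isSelfAdjoint (htr i)]
  have hcU : fsup (fun i => lp (u i)) * wsum u = wsum u := by
    rw [mul_wsum hu1]
    congr 1
    ext i
    rw [← lp_mul (u i), ← mul_assoc, hc.fsup_mul]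
  have hstaru (i) : star (r i * g i) = u i := by rw [star_mul, hrs, hg.star_eq]
  refine ⟨fun i => lp (u i), hc, hgc, ⟨star (wsum u), ?_, ?_, ?_⟩,
    ⟨wsum u, hUt, hcU, fun z hz => ?_⟩⟩
  · rw [← star_fsup, ← star_mul, hcU]
  · rw [← (ht.isSelfAdjoint : star t = t), ← star_mul, hUt]
  · intro z hz
    refine hc.fsup_mul_eq_zero fun j => lp_mul_eq_zero ?_
    set s := lp (r j * g j) with hs
    have hrj : r j * s = s := residue_mul_lp ht j
    have hgs : g j * s = u j := by
      rw [← hstaru, ← lp_mul (r j * g j), star_mul, star_lp, ← hs, star_mul, hrs, hg.star_eq,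
        mul_assoc, hrj]
    have h1 : wsum u * s = (1 / 2 : ℝ) ^ j • u j := by
      rw [wsum_mul hu1, wsum_single j, ← hgs]
      · rw [mul_assoc, hs, lp_mul_lp]
      · intro i hij
        rw [hu]
        simp only [mul_assoc]
        rcases lt_or_gt_of_ne hij with hij | hij
        · have h2 : r i * s = r (i + 1) * s := by
            rw [← hrj, ← mul_assoc, ← mul_assoc, hr, residue_mul_residue ht hij.le,
              residue_mul_residue ht hij]
          have h3 : g i * r (i + 1) = 0 :=
            mul_eq_zero_symm (hrs _) (hg.star_eq i) (residue_succ_mul ht i)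
          rw [h2, ← mul_assoc, h3, zero_mul]
        · have h2 : r i * r (j + 1) = r i :=
            mul_eq_of_mul_eq (hrs i) (hrs _) (residue_mul_residue ht hij)
          rw [← h2, mul_assoc (r i), hs, hr, residue_succ_mul_lp ht, mul_zero, mul_zero]
    have h2 : star (wsum u * s) * z = 0 := by rw [star_mul, mul_assoc, hz, mul_zero]
    rw [h1, star_smul, smul_mul_assoc] at h2
    exact (smul_eq_zero.1 h2).resolve_left (by simp)
  · have hz' (i) : u i * z = 0 := by
      refine (wsum_mul_eq_zero_iff hu1 hgu (fun j k hjk => ?_)).1 hz i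
      rw [← hgu k, ← mul_assoc, hg.orth j k hjk.symm, zero_mul]
    have h1 (i) : r i * z = t * z := by
      induction i with
      | zero => rfl
      | succ i ih =>
        rw [hr, residue_succ, sub_mul, ← hr, ih, lp_mul_eq_zero, sub_zero]
        rw [hstaru, hz']
    refine h (t * z) (by rw [← mul_assoc, ht.isIdempotentElem.eq]) fun i => ?_
    rw [← h1 i, ← mul_assoc]
    exact hz' i

end

section

variable {A : Type*} [CStarAlgebra A]

lemma IsFrame.mul_eq_zero_of_le_sub {e c d : ℕ → A} (he : IsFrame e) (hc : IsFrame c)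
    (hec : ∀ i, e i * c i = c i) (hed : ∀ i, e i * d i = d i)
    (h : ∀ i, c i * d i = 0) (i j : ℕ) : c i * d j = 0 := by
  rcases eq_or_ne i j with rfl | hij
  · exact h i
  · exact mul_eq_zero_of_le (hc.star_eq i) (he.star_eq i) (hec i) (hed j) (he.orth i j hij)

lemma IsFrame.restrict {e : ℕ → A} (he : IsFrame e) (P : ℕ → Prop) [DecidablePred P] :
    IsFrame fun i => if P i then e i else 0 :=
  he.of_le (fun i => by split_ifs; exacts [he.proj i, .zero _]) fun i => by
    split_ifs
    · exact he.sq i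
    · exact mul_zero _

lemma IsFrame.psum_le_psum [PartialOrder A] [StarOrderedRing A] {e c : ℕ → A}
    (he : IsFrame e) (hc : IsFrame c) (h : ∀ i, e i * c i = c i) (n : ℕ) : psum c n ≤ psum e n :=
  Finset.sum_le_sum fun i _ => (hc.proj i).le_of_mul_eq_left (he.proj i)
    (mul_eq_of_mul_eq (hc.star_eq i) (he.star_eq i) (h i))

variable [IsRickart A]

lemma IsFrame.mul_fsup_of_le {e c : ℕ → A} (he : IsFrame e) (hc : IsFrame c)
    (h : ∀ i, e i * c i = c i) (i : ℕ) : e i * fsup c = c i := by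
  have h1 : (e i - c i) * fsup c = 0 := hc.mul_fsup_eq_zero fun k => by
    rw [sub_mul]
    rcases eq_or_ne i k with rfl | hik
    · rw [h, hc.sq, sub_self]
    · rw [hc.orth i k hik, ← h k, ← mul_assoc, he.orth i k hik, zero_mul, sub_self]
  rw [sub_mul, hc.mul_fsup, sub_eq_zero] at h1
  exact h1

variable [PartialOrder A] [StarOrderedRing A]

/-- A frame which is strictly compressed by a projection `t` below its supremum, all of whose
members are dominated by `t`, together with two projections dominating `t` and orthogonal to the
tail of the frame. -/
structure CompressedFrame (e : ℕ → A) (t p q : A) (K : ℕ) (θ : ℝ) : Prop where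
  frame : IsFrame e
  proj : IsStarProjection t
  lt_one : θ < 1
  compress : ∀ n, t * psum e n * t ≤ θ • (1 : A)
  fsup_mul : fsup e * t = t
  dom : ∀ i, Dom (e i) t
  proj_left : IsStarProjection p
  proj_right : IsStarProjection q
  mul_eq_zero : p * q = 0
  dom_left : Dom t p
  dom_right : Dom t q
  mul_left : ∀ i, K ≤ i → e i * p = 0
  mul_right : ∀ i, K ≤ i → e i * q = 0

namespace CompressedFrame

variable {e : ℕ → A} {t p q : A} {K : ℕ} {θ : ℝ} (H : CompressedFrame e t p q K θ)

include H

lemma eq_zero {c : ℕ → A} (hc : IsFrame c) (h : ∀ i, e i * c i = c i) (hn : IsNormalFrame c)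
    {x : A} (htx : t * x = x) (hcx : fsup c * x = x) : x = 0 := by
  refine hn.eq_zero H.proj H.lt_one (fun n => le_trans ?_ (H.compress n)) htx hcx
  have := conj_le_conj (H.frame.psum_le_psum hc h n) t
  rwa [H.proj.isSelfAdjoint.star_eq] at this

lemma isNormalFrame {c : ℕ → A} (hc : IsFrame c) (h : ∀ i, e i * c i = c i)
    (h0 : ∀ i, i < K → c i = 0) (hd : Dom (fsup c) t) : IsNormalFrame c := by
  have hz {r : A} (hr : ∀ i, K ≤ i → e i * r = 0) : fsup c * r = 0 :=
    hc.fsup_mul_eq_zero fun i => by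
      rcases lt_or_ge i K with hi | hi
      · rw [h0 i hi, zero_mul]
      · rw [← mul_eq_of_mul_eq (hc.star_eq i) (H.frame.star_eq i) (h i), mul_assoc, hr i hi,
          mul_zero]
  exact isNormalFrame_of_dom hc H.proj_left H.mul_eq_zero (hz H.mul_left) (hz H.mul_right)
    (hd.trans H.dom_left) (hd.trans H.dom_right)

lemma exists_round {f : ℕ → A} (hf : IsFrame f) (hef : ∀ i, e i * f i = f i)
    (hfn : IsNormalFrame f) (n : ℕ) :
    ∃ c : ℕ → A, IsFrame c ∧ (∀ i, (e i - f i) * c i = c i) ∧ (∀ i, i < K + n → c i = 0) ∧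
      Dom (fsup c) t ∧ Dom t (fsup c) := by
  have he := H.frame
  have hd : IsFrame fun i => e i - f i :=
    he.of_le (fun i => isStarProjection_sub (he.proj i) (hf.proj i) (hef i))
      fun i => by rw [mul_sub, he.sq, hef]
  have hed (i) : e i * (e i - f i) = e i - f i := by rw [mul_sub, he.sq, hef]
  have hfe (i) : f i * e i = f i := mul_eq_of_mul_eq (hf.star_eq i) (he.star_eq i) (hef i)
  set φ : ℕ → A := fun i => if i < K + n then e i - f i else 0 with hφ
  set g : ℕ → A := fun i => if K + n ≤ i then e i - f i else 0 with hg
  have hφf : IsFrame φ := hd.restrict _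
  have hgf : IsFrame g := hd.restrict _
  have heφ (i) : e i * φ i = φ i := by
    rw [hφ]; dsimp only; split_ifs
    exacts [hed i, mul_zero _]
  have hfφ : ∀ i j, f i * φ j = 0 := he.mul_eq_zero_of_le_sub hf hef heφ fun i => by
    rw [hφ]; dsimp only; split_ifs
    · rw [mul_sub, hfe, hf.sq, sub_self]
    · exact mul_zero _
  have hφf' (i j) : φ i * f j = 0 := mul_eq_zero_symm (hf.star_eq j) (hφf.star_eq i) (hfφ j i)
  have hn : IsNormalFrame (f + φ) := .add hf hφf hfφ hφf' hfn
    (isNormalFrame_of_eventually_zero hφf (K + n) fun i hi => if_neg (not_lt.2 hi))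
  have hfr : IsFrame (f + φ) := hf.add hφf hfφ hφf'
  have hle (i) : e i * (f + φ) i = (f + φ) i := by
    rw [Pi.add_apply, mul_add, hef, heφ]
  obtain ⟨c, hc, hgc, h1, h2⟩ := exists_frame_dom hgf H.proj fun x htx hgx =>
    H.eq_zero hfr hle hn htx (by
      have hx : fsup e * x = x := by rw [← htx, ← mul_assoc, H.fsup_mul]
      have h1 : fsup e * (x - fsup (f + φ) * x) = 0 := he.fsup_mul_eq_zero fun i => by
        rw [mul_sub, ← mul_assoc, he.mul_fsup_of_le hfr hle, ← sub_mul, ← hgx i]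
        congr 1
        rw [Pi.add_apply, hφ, hg]
        dsimp only
        rcases lt_or_ge i (K + n) with hi | hi
        · rw [if_pos hi, if_neg (not_le.2 hi)]; abel
        · rw [if_pos hi, if_neg (not_lt.2 hi)]; abel
      have h2 : fsup e * fsup (f + φ) = fsup (f + φ) := hfr.mul_fsup_eq fun i => by
        rw [← hle, ← mul_assoc, he.fsup_mul]
      rw [mul_sub, ← mul_assoc, h2, hx, sub_eq_zero] at h1
      exact h1.symm)
  refine ⟨c, hc, fun i => ?_, fun i hi => ?_, h1, h2⟩
  · have := hgc i
    rw [hg] at this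
    dsimp only at this
    split_ifs at this with hi
    · exact this
    · rw [← this, zero_mul, mul_zero]
  · have := hgc i
    rw [hg] at this
    dsimp only at this
    rw [if_neg (not_le.2 hi), zero_mul] at this
    exact this.symm

/-- The frames available at a stage of the exhaustion. -/
def Admissible (e : ℕ → A) : Type _ :=
  {f : ℕ → A // IsFrame f ∧ (∀ i, e i * f i = f i) ∧ IsNormalFrame f}

lemma exists_rounds : ∃ c : ℕ → ℕ → A, (∀ n, IsFrame (c n)) ∧ (∀ n i, e i * c n i = c n i) ∧
    (∀ m n, m ≠ n → ∀ i, c m i * c n i = 0) ∧ (∀ n i, i < K + n → c n i = 0) ∧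
    (∀ n, Dom (fsup (c n)) t) ∧ ∀ n, Dom t (fsup (c n)) := by
  have he := H.frame
  have hstep : ∀ (n : ℕ) (f : Admissible e), ∃ c : ℕ → A, IsFrame c ∧
      (∀ i, (e i - f.1 i) * c i = c i) ∧ (∀ i, i < K + n → c i = 0) ∧
      Dom (fsup c) t ∧ Dom t (fsup c) := fun n f =>
    H.exists_round f.2.1 f.2.2.1 f.2.2.2 n
  choose s hs1 hs2 hs3 hs4 hs5 using hstep
  have hes (n : ℕ) (f : Admissible e) (i : ℕ) : e i * s n f i = s n f i := by
    rw [← hs2, ← mul_assoc, mul_sub, he.sq, f.2.2.1]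
  have hfs0 (n : ℕ) (f : Admissible e) (i : ℕ) : f.1 i * s n f i = 0 := by
    rw [← hs2, ← mul_assoc, mul_sub, f.2.1.sq,
      mul_eq_of_mul_eq (f.2.1.star_eq i) (he.star_eq i) (f.2.2.1 i), sub_self, zero_mul]
  have hfs (n : ℕ) (f : Admissible e) : ∀ i j, f.1 i * s n f j = 0 :=
    he.mul_eq_zero_of_le_sub f.2.1 f.2.2.1 (hes n f) (hfs0 n f)
  have hsf (n : ℕ) (f : Admissible e) (i j : ℕ) : s n f i * f.1 j = 0 :=
    mul_eq_zero_symm (f.2.1.star_eq j) ((hs1 n f).star_eq i) (hfs n f j i)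
  have hadd (n : ℕ) (f : Admissible e) : IsFrame (f.1 + s n f) ∧
      (∀ i, e i * (f.1 + s n f) i = (f.1 + s n f) i) ∧ IsNormalFrame (f.1 + s n f) :=
    ⟨f.2.1.add (hs1 n f) (hfs n f) (hsf n f),
      fun i => by rw [Pi.add_apply, mul_add, f.2.2.1, hes],
      .add f.2.1 (hs1 n f) (hfs n f) (hsf n f) f.2.2.2
        (H.isNormalFrame (hs1 n f) (hes n f) (fun i hi => hs3 n f i (by omega)) (hs4 n f))⟩
  have h0 : IsFrame (0 : ℕ → A) := ⟨fun _ => .zero _, fun _ _ _ => mul_zero _⟩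
  let F : ℕ → Admissible e := fun n => Nat.rec
    ⟨0, h0, fun _ => mul_zero _, isNormalFrame_of_eventually_zero h0 0 fun _ _ => rfl⟩
    (fun n f => ⟨f.1 + s n f, hadd n f⟩) n
  have hF (n : ℕ) : (F (n + 1)).1 = (F n).1 + s n (F n) := rfl
  have hle {m n : ℕ} (hmn : m < n) (i : ℕ) : s m (F m) i * (F n).1 i = s m (F m) i := by
    induction n, hmn using Nat.le_induction with
    | base => rw [hF, Pi.add_apply, mul_add, hsf, zero_add, (hs1 _ _).sq]
    | succ n hmn ih =>
      have h1 : s m (F m) i * s n (F n) i = 0 := by rw [← ih, mul_assoc, hfs, mul_zero]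
      rw [hF, Pi.add_apply, mul_add, ih, h1, add_zero]
  have horth {m n : ℕ} (hmn : m < n) (i : ℕ) : s m (F m) i * s n (F n) i = 0 := by
    rw [← hle hmn, mul_assoc, hfs, mul_zero]
  refine ⟨fun n => s n (F n), fun n => hs1 _ _, fun n => hes _ _, fun m n hmn i => ?_,
    fun n => hs3 _ _, fun n => hs4 _ _, fun n => hs5 _ _⟩
  rcases lt_or_gt_of_ne hmn with h | h
  · exact horth h i
  · exact mul_eq_zero_symm ((hs1 _ _).star_eq i) ((hs1 _ _).star_eq i) (horth h i)

end CompressedFrame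

end

section

variable {A : Type*} [CStarAlgebra A] [IsRickart A] [PartialOrder A] [StarOrderedRing A]

lemma IsNormalFrame.of_three {e δ : ℕ → A} {κ : ℕ → ℕ → A} {R : ℕ → A} {K : ℕ}
    (he : IsFrame e) (hκ : ∀ r, IsFrame (κ r)) (heκ : ∀ r i, e i * κ r i = κ r i)
    (hR : ∀ r, IsStarProjection (R r)) (hRR : ∀ r s, r < 3 → s < 3 → r ≠ s → R r * R s = 0)
    (hRκ : ∀ r i, R r * κ r i = κ r i) (hdom : ∀ r s, Dom (R r) (R s))
    (hδ : ∀ i, δ i = if K ≤ i then e i - (κ 0 i + κ 1 i + κ 2 i) else 0)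
    (hδR : ∀ r i, r < 3 → δ i * R r = 0) (hδd : ∀ r, Dom (fsup δ) (R r)) : IsNormalFrame e := by
  have hκκ (r s) (hr : r < 3) (hs : s < 3) (hrs : r ≠ s) (i j) : κ r i * κ s j = 0 :=
    mul_eq_zero_of_le ((hκ r).star_eq i) (hR r).isSelfAdjoint (hRκ r i) (hRκ s j)
      (hRR r s hr hs hrs)
  have hnκ (r s u) (hr : r < 3) (hs : s < 3) (hu : u < 3) (hrs : r ≠ s) (hru : r ≠ u)
      (hsu : s ≠ u) : IsNormalFrame (κ r) := by
    have h1 : R r * fsup (κ r) = fsup (κ r) := (hκ r).mul_fsup_eq fun i => hRκ r i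
    have h2 : fsup (κ r) * R r = fsup (κ r) :=
      mul_eq_of_mul_eq (star_fsup _) (hR r).isSelfAdjoint h1
    have h3 (v) (hv : v < 3) (hrv : r ≠ v) : fsup (κ r) * R v = 0 := by
      rw [← h2, mul_assoc, hRR r v hr hv hrv, mul_zero]
    have h4 (v) : Dom (fsup (κ r)) (R v) :=
      (Dom.of_le (fsup_mul_fsup _) h1).trans (hdom r v)
    exact isNormalFrame_of_dom (hκ r) (hR s) (hRR s u hs hu hsu) (h3 s hs hrs) (h3 u hu hru)
      (h4 s) (h4 u)
  have hκ01 : IsFrame (κ 0 + κ 1) := (hκ 0).add (hκ 1) (hκκ 0 1 (by simp) (by simp) (by simp))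
    (hκκ 1 0 (by simp) (by simp) (by simp))
  have h012 (i j) : (κ 0 + κ 1) i * κ 2 j = 0 := by
    rw [Pi.add_apply, add_mul, hκκ 0 2 (by simp) (by simp) (by simp),
      hκκ 1 2 (by simp) (by simp) (by simp), add_zero]
  have h012' (i j) : κ 2 i * (κ 0 + κ 1) j = 0 := by
    rw [Pi.add_apply, mul_add, hκκ 2 0 (by simp) (by simp) (by simp),
      hκκ 2 1 (by simp) (by simp) (by simp), add_zero]
  set S := κ 0 + κ 1 + κ 2 with hS
  have hSf : IsFrame S := hκ01.add (hκ 2) h012 h012'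
  have hSn : IsNormalFrame S := .add hκ01 (hκ 2) h012 h012'
    (.add (hκ 0) (hκ 1) (hκκ 0 1 (by simp) (by simp) (by simp))
      (hκκ 1 0 (by simp) (by simp) (by simp)) (hnκ 0 1 2 (by simp) (by simp) (by simp) (by simp)
        (by simp) (by simp)) (hnκ 1 0 2 (by simp) (by simp) (by simp) (by simp)
        (by simp) (by simp)))
    (hnκ 2 0 1 (by simp) (by simp) (by simp) (by simp) (by simp) (by simp))
  have heS (i) : e i * S i = S i := by
    simp only [hS, Pi.add_apply, mul_add, heκ]
  have hd : IsFrame fun i => e i - S i :=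
    he.of_le (fun i => isStarProjection_sub (he.proj i) (hSf.proj i) (heS i))
      fun i => by rw [mul_sub, he.sq, heS]
  have hSd (i) : S i * (e i - S i) = 0 := by
    rw [mul_sub, hSf.sq, mul_eq_of_mul_eq (hSf.star_eq i) (he.star_eq i) (heS i), sub_self]
  have hed (i) : e i * (e i - S i) = e i - S i := by rw [mul_sub, he.sq, heS]
  obtain rfl : δ = fun i => if K ≤ i then e i - S i else 0 := funext hδ
  have hδf := hd.restrict (K ≤ ·)
  have hφf := hd.restrict (¬ K ≤ ·)
  set φ : ℕ → A := fun i => if ¬ K ≤ i then e i - S i else 0 with hφ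
  set δ : ℕ → A := fun i => if K ≤ i then e i - S i else 0 with hδ'
  have heφ (i) : e i * φ i = φ i := by
    rw [hφ]; dsimp only; split_ifs
    exacts [mul_zero _, hed i]
  have heδ (i) : e i * δ i = δ i := by
    rw [hδ']; dsimp only; split_ifs
    exacts [hed i, mul_zero _]
  have hSφ : ∀ i j, S i * φ j = 0 := he.mul_eq_zero_of_le_sub hSf heS heφ fun i => by
    rw [hφ]; dsimp only; split_ifs
    exacts [mul_zero _, hSd i]
  have hSδ : ∀ i j, S i * δ j = 0 := he.mul_eq_zero_of_le_sub hSf heS heδ fun i => by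
    rw [hδ']; dsimp only; split_ifs
    exacts [hSd i, mul_zero _]
  have hφδ : ∀ i j, φ i * δ j = 0 := he.mul_eq_zero_of_le_sub hφf heφ heδ fun i => by
    rw [hφ, hδ']; dsimp only; split_ifs
    exacts [zero_mul _, mul_zero _]
  have hφS (i j) : φ i * S j = 0 := mul_eq_zero_symm (hSf.star_eq j) (hφf.star_eq i) (hSφ j i)
  have hSφf := hSf.add hφf hSφ hφS
  have h1 (i j) : (S + φ) i * δ j = 0 := by rw [Pi.add_apply, add_mul, hSδ, hφδ, add_zero]
  have hsum : e = S + φ + δ := by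
    ext i
    simp only [Pi.add_apply, hφ, hδ']
    split_ifs with hi <;> simp
  have hδ0 (r) (hr : r < 3) : fsup δ * R r = 0 := hδf.fsup_mul_eq_zero fun i => hδR r i hr
  rw [hsum]
  refine .add hSφf hδf h1
    (fun i j => mul_eq_zero_symm (hSφf.star_eq j) (hδf.star_eq i) (h1 j i))
    (.add hSf hφf hSφ hφS hSn
      (isNormalFrame_of_eventually_zero hφf K fun i hi => if_neg (not_not.2 hi)))
    (isNormalFrame_of_dom hδf (hR 0) (hRR 0 1 (by simp) (by simp) (by simp)) (hδ0 0 (by simp))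
      (hδ0 1 (by simp)) (hδd 0) (hδd 1))

lemma CompressedFrame.projection_eq_zero {e : ℕ → A} {t p q : A} {K : ℕ} {θ : ℝ}
    (H : CompressedFrame e t p q K θ) : t = 0 := by
  obtain ⟨c, hc, hec, hcc, hc0, hct, htc⟩ := H.exists_rounds
  have he := H.frame
  refine H.eq_zero he he.sq ?_ H.proj.isIdempotentElem H.fsup_mul
  have hcc' (m n) (hmn : m ≠ n) (i j) : c m i * c n j = 0 :=
    he.mul_eq_zero_of_le_sub (hc m) (hec m) (hec n) (hcc m n hmn) i j
  have hCC (m n) (hmn : m ≠ n) : fsup (c m) * fsup (c n) = 0 :=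
    (hc m).fsup_mul_eq_zero fun i => (hc n).mul_fsup_eq_zero fun j => hcc' m n hmn i j
  set C : ℕ → ℕ → A := fun r n => fsup (c (3 * n + r)) with hC
  have hCf (r) : IsFrame (C r) :=
    ⟨fun n => isStarProjection_fsup _, fun m n hmn => hCC _ _ (by omega)⟩
  set κ : ℕ → ℕ → A := fun r i => psum (fun n => c (3 * n + r) i) (i + 1) with hκ
  have hrow (r i) : IsFrame fun n => c (3 * n + r) i :=
    ⟨fun n => (hc _).proj i, fun m n hmn => hcc _ _ (by omega) i⟩
  have heκ (r i) : e i * κ r i = κ r i := by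
    rw [hκ]
    simp only [psum, Finset.mul_sum, hec]
  have hκf (r) : IsFrame (κ r) := he.of_le (fun i => (hrow r i).isStarProjection_psum _) (heκ r)
  have hRR (r s) (hr : r < 3) (hs : s < 3) (hrs : r ≠ s) : fsup (C r) * fsup (C s) = 0 :=
    (hCf r).fsup_mul_eq_zero fun m => (hCf s).mul_fsup_eq_zero fun n => hCC _ _ (by omega)
  have hRc (r n i) : fsup (C r) * c (3 * n + r) i = c (3 * n + r) i := by
    have h1 : fsup (C r) * fsup (c (3 * n + r)) = fsup (c (3 * n + r)) := (hCf r).fsup_mul n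
    rw [← (hc (3 * n + r)).fsup_mul i, ← mul_assoc, h1]
  have hRκ (r i) : fsup (C r) * κ r i = κ r i := by
    rw [hκ]
    simp only [psum, Finset.mul_sum, hRc]
  have hκc (r n i) : κ r i * c (3 * n + r) i = c (3 * n + r) i := by
    rw [hκ]
    dsimp only
    rw [(hrow r i).psum_mul]
    split_ifs with h
    · rfl
    · rw [hc0 _ i (by omega)]
  have hκc' (r s n i) (hr : r < 3) (hs : s < 3) (hrs : r ≠ s) : κ r i * c (3 * n + s) i = 0 :=
    mul_eq_zero_of_le ((hκf r).star_eq i) (star_fsup _) (hRκ r i) (hRc s n i) (hRR r s hr hs hrs)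
  set δ : ℕ → A := fun i => if K ≤ i then e i - (κ 0 i + κ 1 i + κ 2 i) else 0 with hδ
  have heδ (i) : e i * δ i = δ i := by
    rw [hδ]; dsimp only; split_ifs
    · rw [mul_sub, mul_add, mul_add, he.sq, heκ, heκ, heκ]
    · exact mul_zero _
  have hκκ (r s i) (hr : r < 3) (hs : s < 3) (hrs : r ≠ s) : κ r i * κ s i = 0 :=
    mul_eq_zero_of_le ((hκf r).star_eq i) (star_fsup _) (hRκ r i) (hRκ s i) (hRR r s hr hs hrs)
  have hδf : IsFrame δ := he.of_le (fun i => by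
    rw [hδ]; dsimp only; split_ifs
    · refine isStarProjection_sub (he.proj i) ?_ (by rw [mul_add, mul_add, heκ, heκ, heκ])
      refine ⟨?_, ?_⟩
      · simp [IsIdempotentElem, add_mul, mul_add, hκκ, (hκf _).sq]
      · simp [IsSelfAdjoint, (hκf _).star_eq]
    · exact .zero _) heδ
  have hδc (r n i) (hr : r < 3) : δ i * c (3 * n + r) i = 0 := by
    rw [hδ]; dsimp only; split_ifs
    · rw [sub_mul, add_mul, add_mul, hec]
      interval_cases r
      · rw [hκc 0, hκc' 1 0 _ _ (by simp) (by simp) (by simp),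
          hκc' 2 0 _ _ (by simp) (by simp) (by simp), add_zero, add_zero, add_zero, sub_self]
      · rw [hκc 1, hκc' 0 1 _ _ (by simp) (by simp) (by simp),
          hκc' 2 1 _ _ (by simp) (by simp) (by simp), add_zero, zero_add, sub_self]
      · rw [hκc 2, hκc' 0 2 _ _ (by simp) (by simp) (by simp),
          hκc' 1 2 _ _ (by simp) (by simp) (by simp), zero_add, zero_add, sub_self]
    · exact zero_mul _
  have hδR (r i) (hr : r < 3) : δ i * fsup (C r) = 0 :=
    (hCf r).mul_fsup_eq_zero fun n => (hc _).mul_fsup_eq_zero fun j =>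
      he.mul_eq_zero_of_le_sub hδf heδ (hec _) (fun i => hδc r n i hr) i j
  exact .of_three he hκf heκ (fun r => isStarProjection_fsup (C r)) hRR hRκ
    (fun r s => .fsup (hCf r) (hCf s) fun n => (hct _).trans (htc _)) (fun i => rfl) hδR
    fun r => .fsup hδf (hCf r) fun i =>
      ((Dom.of_le (hδf.sq i) (heδ i)).trans (H.dom i)).trans (htc _)

end

section

variable {A : Type*} [CStarAlgebra A] [PartialOrder A] [StarOrderedRing A]

lemma le_smul_one_iff_norm_le {a : A} (ha : 0 ≤ a) {r : ℝ} (hr : 0 ≤ r) :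
    a ≤ r • (1 : A) ↔ ‖a‖ ≤ r := by
  rw [CStarAlgebra.norm_le_iff_le_algebraMap a hr ha, Algebra.algebraMap_eq_smul_one]

lemma mul_star_self_le_smul_one {a : A} {r : ℝ} (hr : 0 ≤ r) (h : star a * a ≤ r • (1 : A)) :
    a * star a ≤ r • (1 : A) := by
  rw [le_smul_one_iff_norm_le (star_mul_self_nonneg a) hr, CStarRing.norm_star_mul_self] at h
  rwa [le_smul_one_iff_norm_le (mul_star_self_nonneg a) hr, CStarRing.norm_self_mul_star]

/-- If a sequence of projections does not detect a positive element of norm greater than one,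
then it strictly compresses a nonzero projection. -/
lemma exists_compressed_projection [IsRickart A] {W : A} (hW : 0 ≤ W) {μ : ℝ} (hμ0 : 0 < μ)
    (hμ : μ < ‖W‖) : ∃ s : A, IsStarProjection s ∧ s ≠ 0 ∧ μ • s ≤ W ∧
      ∀ E, E * W = W → E * s = s := by
  set d := W - μ • (1 : A) with hd
  have hds : IsSelfAdjoint d := hW.isSelfAdjoint.sub ((IsSelfAdjoint.all μ).smul (.one A))
  set m := d⁺ with hm
  set n := d⁻ with hn
  have hmn : m * n = 0 := CFC.posPart_mul_negPart d
  have hnm : n * m = 0 := CFC.negPart_mul_posPart d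
  have hdmn : m - n = d := CFC.posPart_sub_negPart d hds
  have hm0 : 0 ≤ m := CFC.posPart_nonneg d
  have hn0 : 0 ≤ n := CFC.negPart_nonneg d
  have hms : star m = m := hm0.isSelfAdjoint
  have hWd : W = μ • (1 : A) + m - n := by rw [add_sub_assoc, hdmn, hd]; abel
  have hss : star (lp m) = lp m := star_lp m
  have hns : n * lp m = 0 := mul_lp hnm
  have hsn : lp m * n = 0 := mul_eq_zero_symm hn0.isSelfAdjoint hss hns
  have hsm : lp m * m = m := lp_mul m
  refine ⟨lp m, isStarProjection_lp m, fun h => ?_, ?_, fun E hE => mul_lp_eq_of_mul_eq ?_⟩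
  · rw [h, zero_mul] at hsm
    rw [← hsm, add_zero] at hWd
    have : W ≤ μ • (1 : A) := by rw [hWd]; exact sub_le_self _ hn0
    rw [le_smul_one_iff_norm_le hW hμ0.le] at this
    linarith
  · have h1 : W - μ • lp m = star (1 - lp m) * W * (1 - lp m) + m := by
      rw [hWd]
      simp only [star_sub, star_one, hss, sub_mul, mul_sub, mul_add, one_mul, mul_one,
        hns, hsn, hsm, smul_mul_assoc, mul_smul_comm, lp_mul_lp, smul_sub, sub_self, sub_zero,
        add_zero]
      abel
    rw [← sub_nonneg, h1]
    exact add_nonneg (star_left_conjugate_nonneg hW _) hm0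
  · have h1 : W * m = μ • m + m * m := by
      rw [hWd, sub_mul, add_mul, hnm, sub_zero, smul_mul_assoc, one_mul]
    have h2 : (1 - E) * (W * m) = 0 := by rw [← mul_assoc, sub_mul, hE, one_mul, sub_self, zero_mul]
    rw [h1, mul_add, mul_smul_comm] at h2
    have h3 : μ • ((1 - E) * m * star (1 - E)) + ((1 - E) * m) * star ((1 - E) * m) = 0 := by
      have := congrArg (· * star (1 - E)) h2
      simpa only [add_mul, smul_mul_assoc, star_mul, hms, mul_assoc, zero_mul] using this
    have h4 : 0 ≤ μ • ((1 - E) * m * star (1 - E)) :=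
      smul_nonneg hμ0.le (star_right_conjugate_nonneg hm0 _)
    have h5 : ((1 - E) * m) * star ((1 - E) * m) ≤ 0 := by
      rw [← h3]; exact le_add_of_nonneg_left h4
    have h6 := (CStarRing.mul_star_self_eq_zero_iff _).1 (le_antisymm h5 (mul_star_self_nonneg _))
    rw [sub_mul, one_mul, sub_eq_zero] at h6
    exact h6.symm

variable [IsRickart A]

theorem isNormalFrame {e : ℕ → A} (he : IsFrame e) : IsNormalFrame e := by
  refine isNormalFrame_of_norm he fun y hy => ?_
  by_contra! hcon
  set W := star (y * fsup e) * (y * fsup e) with hWdef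
  have hW : 0 ≤ W := star_mul_self_nonneg _
  have hW1 : 1 < ‖W‖ := by rw [CStarRing.norm_star_mul_self]; nlinarith
  obtain ⟨μ, hμ1, hμ⟩ := exists_between hW1
  obtain ⟨s, hs, hs0, hsW, hEs⟩ := exists_compressed_projection hW (by linarith) hμ
  have hss : star s = s := hs.isSelfAdjoint
  have hes : fsup e * s = s := hEs _ (by
    simp only [hWdef, star_mul, star_fsup, ← mul_assoc, fsup_mul_fsup])
  have hθ : μ⁻¹ < 1 := inv_lt_one_of_one_lt₀ hμ1
  have hμ0 : 0 < μ := by linarith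
  have hcomp (n) : s * psum e n * s ≤ μ⁻¹ • (1 : A) := by
    have h1 : star (psum e n) * W * psum e n ≤ 1 := by
      have h2 : star (psum e n) * W * psum e n = star (y * psum e n) * (y * psum e n) := by
        have h3 := he.psum_mul_fsup n
        have h5 : fsup e * psum e n = psum e n := by
          rw [← star_fsup, ← he.isSelfAdjoint_psum, ← star_mul, h3]
        rw [hWdef, star_mul, star_mul, star_fsup, he.isSelfAdjoint_psum]
        simp only [mul_assoc, h5]
        rw [← mul_assoc (psum e n), h3]
      rw [h2, ← CStarAlgebra.norm_le_one_iff_of_nonneg _ (star_mul_self_nonneg _),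
        CStarRing.norm_star_mul_self]
      nlinarith [hy n, norm_nonneg (y * psum e n)]
    have h2 := (conj_le_conj' hsW (psum e n)).trans h1
    have h3 : star (s * psum e n) * (s * psum e n) ≤ μ⁻¹ • (1 : A) := by
      have h4 := smul_le_smul_of_nonneg_left h2 (inv_nonneg.2 hμ0.le)
      refine le_of_eq_of_le ?_ h4
      rw [mul_smul_comm, smul_mul_assoc, smul_smul, inv_mul_cancel₀ hμ0.ne', one_smul, star_mul,
        hss, mul_assoc, ← mul_assoc s, hs.isIdempotentElem.eq, mul_assoc]
    have h4 := mul_star_self_le_smul_one (inv_nonneg.2 hμ0.le) h3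
    refine le_of_eq_of_le ?_ h4
    rw [star_mul, hss, he.isSelfAdjoint_psum, mul_assoc, mul_assoc, ← mul_assoc (psum e n),
      (he.isStarProjection_psum n).isIdempotentElem.eq]
  have hcomp' {t : A} (ht : IsStarProjection t) (hst : s * t = t) (n) :
      t * psum e n * t ≤ μ⁻¹ • (1 : A) := by
    have hts := mul_eq_of_mul_eq ht.isSelfAdjoint hss hst
    have h1 := conj_le_conj (hcomp n) t
    have h2 : t * (s * psum e n * s) * star t = t * psum e n * t := by
      rw [ht.isSelfAdjoint.star_eq, mul_assoc, mul_assoc (s * _), hst, ← mul_assoc,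
        ← mul_assoc, hts]
    rw [h2, mul_smul_comm, mul_one, smul_mul_assoc, ht.isSelfAdjoint.star_eq,
      ht.isIdempotentElem.eq] at h1
    exact h1.trans (smul_le_smul_of_nonneg_left ht.le_one (inv_nonneg.2 hμ0.le))
  have hsup {z : A} (hz : s * z = z) (h : ∀ i, e i * z = 0) : z = 0 := by
    have := he.fsup_mul_eq_zero h
    rwa [← hz, ← mul_assoc, hes, hz] at this
  obtain ⟨k, hk⟩ : ∃ k, e k * s ≠ 0 := by
    by_contra! h
    exact hs0 (hsup hs.isIdempotentElem h)
  have hinj {a x : A} {i : ℕ} (ha : IsStarProjection a) (hx : lp (a * e i) * x = x)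
      (h : e i * x = 0) : x = 0 := by
    have h1 : a * x = x := by
      rw [← hx, ← mul_assoc, mul_lp_eq_of_mul_eq]
      rw [← mul_assoc, ha.isIdempotentElem.eq]
    rw [← hx]
    apply lp_mul_eq_zero
    rw [star_mul, he.star_eq, ha.isSelfAdjoint.star_eq, mul_assoc, h1, h]
  have hle {a b : A} (ha : IsStarProjection a) : a * lp (a * b) = lp (a * b) :=
    mul_lp_eq_of_mul_eq (by rw [← mul_assoc, ha.isIdempotentElem.eq])
  have hlp {a b : A} (h : a * b ≠ 0) : lp (a * b) ≠ 0 := fun h0 => h (by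
    rw [← lp_mul (a * b), h0, zero_mul])
  have hflip {a : A} {i : ℕ} (ha : star a = a) (h : e i * a ≠ 0) : a * e i ≠ 0 := fun h0 =>
    h (mul_eq_zero_symm ha (he.star_eq i) h0)
  set r := lp (s * e k) with hr
  have hrp : IsStarProjection r := isStarProjection_lp _
  have hr0 : r ≠ 0 := hlp (hflip hss hk)
  have hsr : s * r = r := hle hs
  obtain ⟨j, hjk, hj⟩ : ∃ j, j ≠ k ∧ e j * r ≠ 0 := by
    by_contra! h
    have h1 : fsup e * (e k * r - r) = 0 := he.fsup_mul_eq_zero fun i => by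
      rw [mul_sub]
      rcases eq_or_ne i k with rfl | hik
      · rw [← mul_assoc, he.sq, sub_self]
      · rw [h i hik, ← mul_assoc, he.orth i k hik, zero_mul, sub_self]
    have h2 : e k * r = r := by
      rwa [mul_sub, ← mul_assoc, he.fsup_mul, ← hsr, ← mul_assoc (fsup e), hes, hsr,
        sub_eq_zero] at h1
    have h3 := hcomp' hrp hsr (k + 1)
    have h4 : r * psum e (k + 1) * r = r := by
      rw [mul_assoc]
      nth_rw 2 [← h2]
      rw [← mul_assoc (psum e (k + 1)), he.psum_mul, if_pos (Nat.lt_succ_self k), h2,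
        hrp.isIdempotentElem.eq]
    rw [h4, le_smul_one_iff_norm_le hrp.nonneg (inv_nonneg.2 hμ0.le)] at h3
    have h5 : ‖r‖ = ‖r‖ * ‖r‖ := by
      rw [← CStarRing.norm_star_mul_self, hrp.isSelfAdjoint.star_eq, hrp.isIdempotentElem.eq]
    have h6 : ‖r‖ = 1 := by
      have := norm_ne_zero_iff.2 hr0
      field_simp at h5
      exact h5.symm
    linarith
  set t := lp (r * e j) with ht
  have htp : IsStarProjection t := isStarProjection_lp _
  have hrt : r * t = t := hle hrp
  have hst : s * t = t := by rw [← hrt, ← mul_assoc, hsr]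
  have hdom {i : ℕ} (hi : ∀ x, t * x = x → e i * x = 0 → x = 0) : Dom t (e i) :=
    ⟨e i * t, by rw [mul_assoc, htp.isIdempotentElem.eq], by rw [← mul_assoc, he.sq], fun z hz =>
      hi _ (by rw [← mul_assoc, htp.isIdempotentElem.eq]) (by rw [← mul_assoc, hz])⟩
  have het (i) : e i * lp (e i * t) = lp (e i * t) := hle (he.proj i)
  have hf : IsFrame fun i => lp (e i * t) := he.of_le (fun i => isStarProjection_lp _) het
  refine hlp (hflip hrp.isSelfAdjoint hj) (CompressedFrame.projection_eq_zero
    (e := fun i => lp (e i * t)) (p := e k) (q := e j) (K := max k j + 1) (θ := μ⁻¹)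
    ⟨hf, htp, hθ, fun n => ?_, ?_, fun i => ?_, he.proj k, he.proj j, he.orth k j hjk.symm,
      hdom fun x htx hx => ?_, hdom fun x htx hx => hinj hrp htx hx, fun i hi => ?_,
      fun i hi => ?_⟩)
  · refine le_trans ?_ (hcomp' htp hst n)
    have := conj_le_conj (he.psum_le_psum hf het n) t
    rwa [htp.isSelfAdjoint.star_eq] at this
  · have h1 : fsup e * (t - fsup (fun i => lp (e i * t)) * t) = 0 := he.fsup_mul_eq_zero fun i => by
      have h2 : lp (e i * t) * e i = lp (e i * t) :=
        mul_eq_of_mul_eq (star_lp _) (he.star_eq i) (het i)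
      have h3 : lp (e i * t) * t = e i * t := by rw [← h2, mul_assoc, lp_mul]
      rw [mul_sub, ← mul_assoc, he.mul_fsup_of_le hf het i, h3, sub_self]
    have h2 : fsup e * fsup (fun i => lp (e i * t)) = fsup fun i => lp (e i * t) :=
      hf.mul_fsup_eq fun i => by rw [← het, ← mul_assoc, he.fsup_mul]
    rw [mul_sub, ← mul_assoc, h2, ← hst, ← mul_assoc (fsup e), hes, hst, sub_eq_zero] at h1
    exact h1.symm
  · refine ⟨star (e i * t), ?_, ?_, fun z hz => lp_mul_eq_zero hz⟩
    · rw [← star_lp, ← star_mul, lp_mul]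
    · rw [star_mul, htp.isSelfAdjoint.star_eq, ← mul_assoc, htp.isIdempotentElem.eq]
  · exact hinj hs (by rw [← hr, ← htx, ← mul_assoc, hrt]) hx
  · exact mul_eq_zero_of_le (star_lp _) (he.star_eq i) (het i) (he.sq k)
      (he.orth i k (by omega))
  · exact mul_eq_zero_of_le (star_lp _) (he.star_eq i) (het i) (he.sq j)
      (he.orth i j (by omega))

end

section

variable {A : Type*} [CStarAlgebra A]

/-- An increasing sequence of projections. -/
structure IsIncreasing (E : ℕ → A) : Prop where
  proj : ∀ n, IsStarProjection (E n)
  succ : ∀ n, E (n + 1) * E n = E n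

/-- The differences of a sequence. -/
def diff (E : ℕ → A) : ℕ → A
  | 0 => E 0
  | n + 1 => E (n + 1) - E n

lemma psum_diff_succ (E : ℕ → A) (n : ℕ) : psum (diff E) (n + 1) = E n := by
  induction n with
  | zero => simp [psum, diff]
  | succ n ih => rw [psum_succ, ih, diff]; abel

namespace IsIncreasing

variable {E : ℕ → A} (hE : IsIncreasing E)
include hE

lemma star_eq (n : ℕ) : star (E n) = E n := (hE.proj n).isSelfAdjoint

lemma sq (n : ℕ) : E n * E n = E n := (hE.proj n).isIdempotentElem

lemma mul_of_le {m n : ℕ} (h : m ≤ n) : E n * E m = E m := by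
  induction n, h using Nat.le_induction with
  | base => exact hE.sq m
  | succ n _ ih => rw [← ih, ← mul_assoc, hE.succ]

lemma mul_of_ge {m n : ℕ} (h : m ≤ n) : E m * E n = E m :=
  mul_eq_of_mul_eq (hE.star_eq m) (hE.star_eq n) (hE.mul_of_le h)

lemma isStarProjection_diff (n : ℕ) : IsStarProjection (diff E n) := by
  cases n with
  | zero => exact hE.proj 0
  | succ n => exact isStarProjection_sub (hE.proj _) (hE.proj _) (hE.succ n)

lemma mul_diff {k n : ℕ} (h : k ≤ n) : E n * diff E k = diff E k := by
  cases k with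
  | zero => exact hE.mul_of_le h
  | succ k => rw [diff, mul_sub, hE.mul_of_le h, hE.mul_of_le (by omega)]

lemma mul_diff_eq_zero {k n : ℕ} (h : n < k) : E n * diff E k = 0 := by
  cases k with
  | zero => omega
  | succ k => rw [diff, mul_sub, hE.mul_of_ge h.le, hE.mul_of_ge (by omega), sub_self]

lemma isFrame_diff : IsFrame (diff E) := by
  have key (i j : ℕ) (h : i < j) : diff E i * diff E j = 0 := by
    rw [← mul_eq_of_mul_eq (hE.isStarProjection_diff i).isSelfAdjoint (hE.star_eq i)
      (hE.mul_diff le_rfl), mul_assoc, hE.mul_diff_eq_zero h, mul_zero]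
  refine ⟨hE.isStarProjection_diff, fun i j hij => ?_⟩
  rcases lt_or_gt_of_ne hij with h | h
  · exact key i j h
  · exact mul_eq_zero_symm (hE.isStarProjection_diff j).isSelfAdjoint
      (hE.isStarProjection_diff i).isSelfAdjoint (key j i h)

end IsIncreasing

variable [IsRickart A]

/-- The supremum of an increasing sequence of projections. -/
noncomputable def isup (E : ℕ → A) : A := fsup (diff E)

lemma isStarProjection_isup (E : ℕ → A) : IsStarProjection (isup E) := isStarProjection_fsup _

lemma star_isup (E : ℕ → A) : star (isup E) = isup E := star_fsup _

lemma isup_mul_isup (E : ℕ → A) : isup E * isup E = isup E := fsup_mul_fsup _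

namespace IsIncreasing

variable {E : ℕ → A} (hE : IsIncreasing E)
include hE

lemma mul_isup (n : ℕ) : E n * isup E = E n := by
  rw [← psum_diff_succ E n]
  exact hE.isFrame_diff.psum_mul_fsup _

lemma isup_mul (n : ℕ) : isup E * E n = E n := by
  rw [← hE.star_eq, ← star_isup, ← star_mul, hE.mul_isup]

lemma isup_mul_eq_zero {y : A} (h : ∀ n, E n * y = 0) : isup E * y = 0 :=
  hE.isFrame_diff.fsup_mul_eq_zero fun k => by
    rw [← mul_eq_of_mul_eq (hE.isStarProjection_diff k).isSelfAdjoint (hE.star_eq k)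
      (hE.mul_diff le_rfl), mul_assoc, h, mul_zero]

lemma mul_isup_eq_zero {y : A} (h : ∀ n, y * E n = 0) : y * isup E = 0 :=
  hE.isFrame_diff.mul_fsup_eq_zero fun k => by
    rw [← hE.mul_diff (le_refl k), ← mul_assoc, h, zero_mul]

lemma isup_mul_eq {y : A} (h : ∀ n, y * E n = E n) : y * isup E = isup E := by
  have := hE.mul_isup_eq_zero (y := y - 1) fun n => by rw [sub_mul, h, one_mul, sub_self]
  rwa [sub_mul, one_mul, sub_eq_zero] at this

variable [PartialOrder A] [StarOrderedRing A]

lemma conj_isup_le {y D : A} (h : ∀ n, y * E n * star y ≤ D) : y * isup E * star y ≤ D := by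
  refine isNormalFrame hE.isFrame_diff y D fun n => ?_
  cases n with
  | zero =>
    rw [psum_zero, mul_zero, zero_mul]
    exact (star_right_conjugate_nonneg (hE.proj 0).nonneg y).trans (h 0)
  | succ n =>
    rw [psum_diff_succ]
    exact h n

end IsIncreasing

end

section

variable {A : Type*} [CStarAlgebra A] [PartialOrder A] [StarOrderedRing A]

lemma exists_inv_one_add {a : A} (ha : 0 ≤ a) :
    ∃ k : A, k * (1 + a) = 1 ∧ (1 + a) * k = 1 ∧ star k = k := by
  have hpos : IsStrictlyPositive (1 + a) := .add_nonneg isStrictlyPositive_one ha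
  obtain ⟨u, hu⟩ := hpos.isUnit
  have h1 : (↑u⁻¹ : A) * (1 + a) = 1 := by rw [← hu, Units.inv_mul]
  have h2 : (1 + a) * (↑u⁻¹ : A) = 1 := by rw [← hu, Units.mul_inv]
  refine ⟨↑u⁻¹, h1, h2, ?_⟩
  have h3 : star (↑u⁻¹ : A) * (1 + a) = 1 := by
    have := congrArg star h2
    rwa [star_mul, hpos.nonneg.isSelfAdjoint.star_eq, star_one] at this
  exact left_inv_eq_right_inv h3 h2

/-- The projection onto the graph of a bounded operator makes a positive angle with the target. -/
lemma lp_graph_compression [IsRickart A] {f g z : A} (hf : IsStarProjection f)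
    (hg : IsStarProjection g) (hfg : f * g = 0) (hfz : f * z = z) (hzg : z * g = z) {M : ℝ}
    (hz : ‖z‖ ^ 2 ≤ M) : f * lp (g + z) * star f ≤ (M / (1 + M)) • (1 : A) := by
  have hfs : star f = f := hf.isSelfAdjoint
  have hgs : star g = g := hg.isSelfAdjoint
  have hgg : g * g = g := hg.isIdempotentElem
  have hgf : g * f = 0 := mul_eq_zero_symm hfs hgs hfg
  have hgz : g * z = 0 := by rw [← hfz, ← mul_assoc, hgf, zero_mul]
  have hzg' : star z * g = 0 := by rw [← hgs, ← star_mul, hgz, star_zero]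
  have hgz' : g * star z = star z := by rw [← hgs, ← star_mul, hzg]
  have hM : 0 ≤ M := (sq_nonneg _).trans hz
  obtain ⟨k, hk1, hk2, hks⟩ := exists_inv_one_add (star_mul_self_nonneg z)
  have hkg : k * (1 - g) = 1 - g := by
    linear_combination (norm := noncomm_ring) hk1 * (1 - g) + k * star z * hzg
  have hkt : k * (g + star z * z) = g := by
    linear_combination (norm := noncomm_ring) hk1 - hkg
  have htg : (g + z) * g = g + z := by rw [add_mul, hgg, hzg]
  have hts : star (g + z) * (g + z) = g + star z * z := by
    rw [star_add, hgs]
    linear_combination (norm := noncomm_ring) hgg + hgz + hzg'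
  set τ := g + z with hτ
  set P := τ * k * star τ with hP
  have hPτ : P * τ = τ := by
    rw [hP, mul_assoc, hts, mul_assoc, hkt, htg]
  have hPs : star P = P := by simp [hP, hks, mul_assoc]
  have hlp : lp τ = P := by
    have h1 : P * lp τ = lp τ := mul_lp_eq_of_mul_eq hPτ
    have h2 : lp τ * P = P := by rw [hP, mul_assoc, ← mul_assoc (lp τ), lp_mul]
    have h3 := congrArg star h2
    rw [star_mul, hPs, star_lp, h1] at h3
    exact h3
  have hfτ : f * τ = z := by rw [hτ, mul_add, hfg, hfz, zero_add]
  rw [hlp]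
  have hPP : P * P = P := by rw [← hlp, lp_mul_lp]
  have h1 : star z * z ≤ (M / (1 + M)) • (1 + star z * z) := by
    have h2 : star z * z ≤ M • (1 : A) := by
      rw [le_smul_one_iff_norm_le (star_mul_self_nonneg z) hM, CStarRing.norm_star_mul_self, ← sq]
      exact hz
    have h3 := smul_le_smul_of_nonneg_left h2 (by positivity : 0 ≤ (1 + M)⁻¹)
    rw [← sub_nonneg] at h3 ⊢
    have h4 : (M / (1 + M)) • (1 + star z * z) - star z * z
        = (1 + M)⁻¹ • M • (1 : A) - (1 + M)⁻¹ • (star z * z) := by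
      have : (1 + M) ≠ 0 := by positivity
      match_scalars <;> field_simp
      ring
    rwa [h4]
  have h2 : star (f * P) * (f * P) ≤ (M / (1 + M)) • (1 : A) := by
    have h3 : star (f * P) * (f * P) = (τ * k) * (star z * z) * star (τ * k) := by
      rw [star_mul, hfs, hPs, mul_assoc, ← mul_assoc f, hf.isIdempotentElem.eq]
      have h4 : f * P = z * k * star τ := by rw [hP, ← mul_assoc, ← mul_assoc, hfτ]
      have h5 : P * f = τ * k * star z := by
        rw [← hPs, ← hfs, ← star_mul, h4]; simp [hks, mul_assoc]
      calc P * (f * P) = (P * f) * (f * P) := by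
            rw [mul_assoc P f, ← mul_assoc f f, hf.isIdempotentElem.eq]
        _ = _ := by rw [h4, h5]; simp [hks, mul_assoc]
    have h4 : (τ * k) * (1 + star z * z) * star (τ * k) = P := by
      rw [mul_assoc τ, hk1, mul_one, star_mul, hks, ← mul_assoc]
    have h5 := conj_le_conj h1 (τ * k)
    rw [← h3, mul_smul_comm, smul_mul_assoc, h4] at h5
    refine h5.trans (smul_le_smul_of_nonneg_left ?_ (by positivity))
    rw [← hlp]
    exact (isStarProjection_lp τ).le_one
  have h3 := mul_star_self_le_smul_one (by positivity) h2
  rwa [star_mul, hPs, mul_assoc, ← mul_assoc P, hPP, ← mul_assoc] at h3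

variable [IsRickart A]

/-- A bounded compatible sequence of elements with range under a projection `f`, supported under
an increasing sequence of projections orthogonal to `f`, has a common extension. -/
lemma exists_extension_of_orthogonal {f : A} {g z : ℕ → A} (hf : IsStarProjection f)
    (hg : IsIncreasing g) (hfg : ∀ n, f * g n = 0) (hfz : ∀ n, f * z n = z n)
    (hzg : ∀ n, z n * g n = z n) (hz : ∀ n, z (n + 1) * g n = z n) {M : ℝ}
    (hM : ∀ n, ‖z n‖ ≤ M) : ∃ w : A, f * w = w ∧ ∀ n, w * g n = z n := by
  have hfs : star f = f := hf.isSelfAdjoint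
  set τ : ℕ → A := fun n => g n + z n with hτ
  have hτg (n) : τ (n + 1) * g n = τ n := by rw [hτ, add_mul, hg.succ, hz]
  set P : ℕ → A := fun n => lp (τ n) with hP
  have hPi : IsIncreasing P := ⟨fun n => isStarProjection_lp _, fun n => mul_lp_eq_of_mul_eq (by
    rw [← hτg, ← mul_assoc, hP, lp_mul])⟩
  set θ : ℝ := M ^ 2 / (1 + M ^ 2) with hθ
  have hθ0 : 0 ≤ θ := by positivity
  have hθ1 : θ < 1 := by rw [hθ, div_lt_one (by positivity)]; linarith
  have h1 : f * isup P * star f ≤ θ • (1 : A) := hPi.conj_isup_le fun n =>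
    lp_graph_compression hf (hg.proj n) (hfg n) (hfz n) (hzg n)
      (pow_le_pow_left₀ (norm_nonneg _) (hM n) 2)
  set Q := isup P with hQ
  have hQs : star Q = Q := star_isup P
  have hQQ : Q * Q = Q := isup_mul_isup P
  have h2 : ‖Q * f * Q‖ < 1 := by
    have h3 : star (Q * f) * (Q * f) ≤ θ • (1 : A) := by
      refine le_of_eq_of_le ?_ h1
      rw [star_mul, hQs, hfs, mul_assoc, ← mul_assoc Q, hQQ, ← mul_assoc]
    have h4 := mul_star_self_le_smul_one hθ0 h3
    rw [le_smul_one_iff_norm_le (mul_star_self_nonneg _) hθ0] at h4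
    have h5 : Q * f * star (Q * f) = Q * f * Q := by
      rw [star_mul, hQs, hfs, mul_assoc, ← mul_assoc f, hf.isIdempotentElem.eq, ← mul_assoc]
    rw [h5] at h4
    linarith
  set u := Units.oneSub _ h2 with hu
  have huv : (↑u⁻¹ : A) * (1 - Q * f * Q) = 1 := u.inv_mul
  refine ⟨f * ↑u⁻¹ * Q, by rw [← mul_assoc, ← mul_assoc, hf.isIdempotentElem.eq], fun n => ?_⟩
  have hQτ : Q * τ n = τ n := by
    have h3 : P n * τ n = τ n := lp_mul _
    rw [← h3, ← mul_assoc, hPi.isup_mul]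
  have h3 : (1 - Q * f * Q) * τ n = Q * g n := by
    have h4 : τ n - f * τ n = g n := by
      rw [hτ]
      simp only [mul_add, hfg, hfz]
      abel
    rw [sub_mul, one_mul, mul_assoc, hQτ, mul_assoc, ← h4, mul_sub, hQτ]
  have h4 : τ n = ↑u⁻¹ * (Q * g n) := by
    rw [← h3, ← mul_assoc, huv, one_mul]
  calc f * ↑u⁻¹ * Q * g n = f * (↑u⁻¹ * (Q * g n)) := by simp only [mul_assoc]
    _ = f * τ n := by rw [h4]
    _ = z n := by rw [hτ]; simp only [mul_add, hfg, hfz, zero_add]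

end

section Multipliers

open scoped MultiplierAlgebra

variable {A : Type*} [CStarAlgebra A] [IsRickart A]
  {J : Type*} [NonUnitalCStarAlgebra J] (φ : J →⋆ₙₐ[ℂ] A) {h : J}

/-- A self-adjoint contractive multiplier acts on `h` as the average of a contraction `S`
of the ambient algebra and of `S` times another self-adjoint contractive multiplier. -/
lemma exists_symmetry_of_multiplier (hh : star h = h) {w : 𝓜(ℂ, J)}
    (hw : IsSelfAdjoint w) (hw1 : ‖w‖ ≤ 1) :
    ∃ (S : A) (v : 𝓜(ℂ, J)), ‖S‖ ≤ 1 ∧ IsSelfAdjoint v ∧ ‖v‖ ≤ 1 ∧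
      (2 : ℝ) • φ (w.fst h) = S * φ h + S * φ (v.fst h) := by
  set a : 𝓜(ℂ, J) := w⁺ with ha
  set b : 𝓜(ℂ, J) := w⁻ with hb
  have hab : a * b = 0 := CFC.posPart_mul_negPart w
  have hwab : a - b = w := CFC.posPart_sub_negPart w hw
  have has : star a = a := by
    rw [ha, CFC.posPart_def]; exact cfcₙ_predicate (R := ℝ) (p := IsSelfAdjoint) _ w
  have hbs : star b = b := by
    rw [hb, CFC.negPart_def]; exact cfcₙ_predicate (R := ℝ) (p := IsSelfAdjoint) _ w
  have horth : star (φ (a.fst h)) * φ (b.fst h) = 0 := by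
    rw [← map_star, ← map_mul]
    have h1 : star (a.fst h) = a.snd h := by
      conv_lhs => rw [← has]
      rw [DoubleCentralizer.star_fst, star_star, hh]
    have h2 : a.fst (b.fst h) = (a * b).fst h := by simp
    rw [h1, a.central, h2, hab]
    simp
  set P := lp (φ (a.fst h)) with hP
  have hPa : P * φ (a.fst h) = φ (a.fst h) := lp_mul _
  have hPb : P * φ (b.fst h) = 0 := lp_mul_eq_zero horth
  have hPs : star P = P := star_lp _
  have hPP : P * P = P := lp_mul_lp _
  refine ⟨2 * P - 1, cfc (fun t : ℝ => 2 * |t| - 1) w, ?_, cfc_predicate _ w, ?_, ?_⟩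
  · have hu : star (2 * P - 1) * (2 * P - 1) = 1 := by
      simp only [star_sub, star_mul, star_ofNat, star_one, hPs]
      linear_combination (norm := noncomm_ring) (4 : A) * hPP
    have h2 : ‖2 * P - 1‖ * ‖2 * P - 1‖ = ‖(1 : A)‖ := by
      rw [← CStarRing.norm_star_mul_self, hu]
    have h3 : ‖(1 : A)‖ ≤ 1 := by
      simpa using (IsStarProjection.one (R := A)).norm_le
    nlinarith [norm_nonneg (2 * P - 1)]
  · refine norm_cfc_le zero_le_one fun t ht => ?_
    have : ‖t‖ ≤ 1 := by
      have h4 := spectrum.norm_le_norm_mul_of_mem ht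
      have h3 : ‖(1 : 𝓜(ℂ, J))‖ ≤ 1 := by
        simpa using (IsStarProjection.one (R := 𝓜(ℂ, J))).norm_le
      nlinarith [norm_nonneg w]
    rw [Real.norm_eq_abs] at *
    rw [abs_le]
    constructor <;> linarith [abs_nonneg t]
  · have hv : cfc (fun t : ℝ => 2 * |t| - 1) w = (2 : ℝ) • (a + b) - 1 := by
      rw [ha, hb, CFC.posPart_def, CFC.negPart_def, cfcₙ_eq_cfc, cfcₙ_eq_cfc,
        ← cfc_add .., ← cfc_smul .., ← cfc_one ℝ w, ← cfc_sub ..]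
      refine cfc_congr fun t _ => ?_
      simp [← posPart_add_negPart]
    have e1 : φ (w.fst h) = φ (a.fst h) - φ (b.fst h) := by
      rw [← hwab]; simp
    have e2 : φ ((cfc (fun t : ℝ => 2 * |t| - 1) w).fst h)
        = (2 : ℝ) • (φ (a.fst h) + φ (b.fst h)) - φ h := by
      have : (2 : ℝ) • (a + b) = a + b + (a + b) := two_smul _ _
      rw [hv, this, two_smul]; simp
    rw [e1, e2, two_smul, two_smul]
    linear_combination (norm := noncomm_ring) (-4 : A) * hPa - (4 : A) * hPb

lemma exists_mul_eq_of_selfAdjoint_of_norm_le (hh : star h = h) {w : 𝓜(ℂ, J)}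
    (hw : IsSelfAdjoint w) (hw1 : ‖w‖ ≤ 1) : ∃ a : A, a * φ h = φ (w.fst h) := by
  classical
  let X := {w : 𝓜(ℂ, J) // IsSelfAdjoint w ∧ ‖w‖ ≤ 1}
  have key (v : X) : ∃ (S : A) (v' : X), ‖S‖ ≤ 1 ∧
      (2 : ℝ) • φ (v.1.fst h) = S * φ h + S * φ (v'.1.fst h) := by
    obtain ⟨S, v', h1, h2, h3, h4⟩ := exists_symmetry_of_multiplier φ hh v.2.1 v.2.2
    exact ⟨S, ⟨v', h2, h3⟩, h1, h4⟩
  choose S f hS hf using key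
  let W : ℕ → X := fun n => f^[n] ⟨w, hw, hw1⟩
  have hW (n : ℕ) : W (n + 1) = f (W n) := Function.iterate_succ_apply' f n _
  let T : ℕ → A := fun n => n.rec 1 fun n t => t * S (W n)
  have hT (n : ℕ) : T (n + 1) = T n * S (W n) := rfl
  have hT1 (n : ℕ) : ‖T n‖ ≤ 1 := by
    induction n with
    | zero => exact (IsStarProjection.one (R := A)).norm_le
    | succ n ih =>
      rw [hT]
      exact (norm_mul_le _ _).trans (mul_le_one₀ ih (norm_nonneg _) (hS _))
  have hT2 (k : ℕ) : ‖(fun k => T (k + 1)) k‖ ≤ 1 := hT1 (k + 1)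
  have hfin (n : ℕ) : (2 : ℝ) • φ (w.fst h) =
      (∑ k ∈ Finset.range n, (1 / 2 : ℝ) ^ k • T (k + 1)) * φ h
        + (2 : ℝ) • ((1 / 2 : ℝ) ^ n • (T n * φ ((W n).1.fst h))) := by
    induction n with
    | zero => simp [T, W]
    | succ n ih =>
      have h1 : T n * φ ((W n).1.fst h) =
          (1 / 2 : ℝ) • (T (n + 1) * φ h + T (n + 1) * φ ((W (n + 1)).1.fst h)) := by
        have : φ ((W n).1.fst h) = (1 / 2 : ℝ) • ((2 : ℝ) • φ ((W n).1.fst h)) := by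
          rw [smul_smul]; norm_num
        rw [this, hf, mul_smul_comm, hT, hW, mul_add, mul_assoc, mul_assoc]
      rw [ih, Finset.sum_range_succ, h1, add_mul, smul_mul_assoc]
      simp only [smul_add, smul_smul]
      rw [add_assoc]
      congr 2
      congr 1; ring
  refine ⟨(1 / 2 : ℝ) • wsum fun k => T (k + 1), ?_⟩
  have hlim : Filter.Tendsto (fun n : ℕ => (1 / 2 : ℝ) ^ n • (T n * φ ((W n).1.fst h)))
      Filter.atTop (nhds 0) := by
    refine squeeze_zero_norm (a := fun n : ℕ => (1 / 2 : ℝ) ^ n * ‖h‖) (fun n => ?_) ?_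
    · rw [norm_smul, norm_pow, Real.norm_of_nonneg (by norm_num : (0 : ℝ) ≤ 1 / 2)]
      gcongr
      refine (norm_mul_le _ _).trans ?_
      have h1 : ‖φ ((W n).1.fst h)‖ ≤ ‖h‖ := by
        refine (NonUnitalStarAlgHom.norm_apply_le φ _).trans ?_
        refine ((W n).1.fst.le_opNorm h).trans ?_
        rw [DoubleCentralizer.norm_fst]
        exact mul_le_of_le_one_left (norm_nonneg _) (W n).2.2
      nlinarith [hT1 n, norm_nonneg (T n), norm_nonneg (φ ((W n).1.fst h))]
    · simpa using (tendsto_pow_atTop_nhds_zero_of_lt_one (r := (1 / 2 : ℝ)) (by norm_num)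
        (by norm_num)).mul_const ‖h‖
  have hsum := (((summable_wsum hT2).hasSum.tendsto_sum_nat).mul_const (φ h)).add
    (hlim.const_smul (2 : ℝ))
  simp only [← hfin, smul_zero, add_zero] at hsum
  have := tendsto_nhds_unique hsum tendsto_const_nhds
  rw [smul_mul_assoc, wsum, this, smul_smul]
  norm_num

/-- Every multiplier acts on a self-adjoint element as an element of the ambient Rickart
algebra. -/
theorem exists_mul_eq (hh : star h = h) (w : 𝓜(ℂ, J)) : ∃ a : A, a * φ h = φ (w.fst h) := by
  have hsa (v : 𝓜(ℂ, J)) (hv : IsSelfAdjoint v) : ∃ a : A, a * φ h = φ (v.fst h) := by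
    set r : ℝ := ‖v‖ + 1 with hr
    have hr0 : 0 < r := by positivity
    have hv' : IsSelfAdjoint (((r⁻¹ : ℝ) : ℂ) • v) := by
      rw [IsSelfAdjoint, star_smul, hv.star_eq]; simp
    obtain ⟨a, ha⟩ := exists_mul_eq_of_selfAdjoint_of_norm_le φ hh hv' (by
      rw [norm_smul, Complex.norm_real, Real.norm_of_nonneg (by positivity), inv_mul_le_one₀ hr0]
      linarith)
    refine ⟨(r : ℂ) • a, ?_⟩
    have hrc : (r : ℂ) ≠ 0 := by exact_mod_cast hr0.ne'
    rw [smul_mul_assoc, ha]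
    simp [smul_smul, hrc]
  obtain ⟨a, ha⟩ := hsa _ (realPart w).2
  obtain ⟨b, hb⟩ := hsa _ (imaginaryPart w).2
  refine ⟨a + Complex.I • b, ?_⟩
  conv_rhs => rw [← realPart_add_I_smul_imaginaryPart w]
  rw [add_mul, smul_mul_assoc, ha, hb]
  simp

end Multipliers

section

variable {A : Type*} [CStarAlgebra A]

/-- The closed two-sided ideal generated by a sequence. -/
def closedIdeal (E : ℕ → A) : AddSubgroup A :=
  (AddSubgroup.closure {x | ∃ (m : ℕ) (b c : A), x = b * E m * c}).topologicalClosure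

lemma mul_mul_mem_closedIdeal (E : ℕ → A) (m : ℕ) (b c : A) : b * E m * c ∈ closedIdeal E :=
  subset_closure (AddSubgroup.subset_closure ⟨m, b, c, rfl⟩)

lemma isClosed_closedIdeal (E : ℕ → A) : IsClosed (closedIdeal E : Set A) := isClosed_closure

lemma closedIdeal_le {E : ℕ → A} {S : AddSubgroup A} (hS : IsClosed (S : Set A))
    (h : ∀ m b c, b * E m * c ∈ S) : closedIdeal E ≤ S := by
  refine AddSubgroup.topologicalClosure_minimal _ ((AddSubgroup.closure_le _).2 ?_) hS
  rintro _ ⟨m, b, c, rfl⟩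
  exact h m b c

lemma mul_mem_closedIdeal_left {E : ℕ → A} (a : A) {x : A} (hx : x ∈ closedIdeal E) :
    a * x ∈ closedIdeal E := by
  refine closedIdeal_le (S := (closedIdeal E).comap (AddMonoidHom.mulLeft a))
    ((isClosed_closedIdeal E).preimage (continuous_const.mul continuous_id)) (fun m b c => ?_) hx
  simpa [mul_assoc] using mul_mul_mem_closedIdeal E m (a * b) c

lemma star_mem_closedIdeal {E : ℕ → A} (hE : ∀ n, star (E n) = E n) {x : A}
    (hx : x ∈ closedIdeal E) : star x ∈ closedIdeal E := by
  refine closedIdeal_le (S := (closedIdeal E).comap (starAddEquiv : A ≃+ A).toAddMonoidHom)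
    ((isClosed_closedIdeal E).preimage continuous_star) (fun m b c => ?_) hx
  simpa [mul_assoc, hE] using mul_mul_mem_closedIdeal E m (star c) (star b)

/-- The closed ideal generated by a self-adjoint sequence, as a C⋆-subalgebra. -/
def idealSubalgebra (E : ℕ → A) (hE : ∀ n, star (E n) = E n) : NonUnitalStarSubalgebra ℂ A where
  carrier := closedIdeal E
  add_mem' := add_mem
  zero_mem' := zero_mem _
  mul_mem' _ h := mul_mem_closedIdeal_left _ h
  smul_mem' c x hx := by
    have := mul_mem_closedIdeal_left (algebraMap ℂ A c) hx
    rwa [← Algebra.smul_def] at this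
  star_mem' := star_mem_closedIdeal hE

/-- A sequence of partial isometries, each extending the preceding one, with initial
projections `E n`. -/
structure IsCoherent (E u : ℕ → A) : Prop where
  inc : IsIncreasing E
  star_mul_eq : ∀ n, star (u n) * u n = E n
  succ : ∀ n, u (n + 1) * E n = u n

namespace IsCoherent

variable {E u : ℕ → A} (hu : IsCoherent E u)
include hu

lemma mul_self (n : ℕ) : u n * E n = u n := by
  have h : star (u n * (1 - E n)) * (u n * (1 - E n)) = 0 := by
    have h1 := hu.inc.sq n
    rw [star_mul, star_sub, star_one, hu.inc.star_eq]
    linear_combination (norm := noncomm_ring)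
      (1 - E n) * hu.star_mul_eq n * (1 - E n) + (E n - 1) * h1
  have := (CStarRing.star_mul_self_eq_zero_iff _).1 h
  rw [mul_sub, mul_one, sub_eq_zero] at this
  exact this.symm

lemma mul_of_le {m n : ℕ} (h : m ≤ n) : u n * E m = u m := by
  induction n, h using Nat.le_induction with
  | base => exact hu.mul_self m
  | succ n h ih => rw [← hu.inc.mul_of_le h, ← mul_assoc, hu.succ, ih]

lemma mul_of_ge {m n : ℕ} (h : m ≤ n) : u m * E n = u m := by
  rw [← hu.mul_self m, mul_assoc, hu.inc.mul_of_ge h]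

lemma star_mul_of_le {m n : ℕ} (h : m ≤ n) : star (u n) * u m = E m := by
  rw [← hu.mul_of_le h, ← mul_assoc, hu.star_mul_eq, hu.inc.mul_of_le h]

lemma range_mul_of_le {m n : ℕ} (h : m ≤ n) : u n * star (u n) * u m = u m := by
  rw [mul_assoc, hu.star_mul_of_le h, hu.mul_of_le h]

lemma mul_star_self (n : ℕ) : E n * star (u n) = star (u n) := by
  rw [← hu.inc.star_eq, ← star_mul, hu.mul_self]

protected lemma star : IsCoherent (fun n => u n * star (u n)) (fun n => star (u n)) where
  inc := by
    refine ⟨fun n => ⟨?_, .mul_star_self _⟩, fun n => ?_⟩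
    · change u n * star (u n) * (u n * star (u n)) = u n * star (u n)
      rw [← mul_assoc, hu.range_mul_of_le le_rfl]
    · rw [← mul_assoc, hu.range_mul_of_le n.le_succ]
  star_mul_eq n := by rw [star_star]
  succ n := by rw [← mul_assoc, hu.star_mul_of_le n.le_succ, hu.mul_star_self]

lemma closedIdeal_range : closedIdeal (fun n => u n * star (u n)) = closedIdeal E := by
  refine le_antisymm (closedIdeal_le (isClosed_closedIdeal _) fun m b c => ?_)
    (closedIdeal_le (isClosed_closedIdeal _) fun m b c => ?_)
  · have := mul_mul_mem_closedIdeal E m (b * u m) (star (u m) * c)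
    rwa [mul_assoc b, hu.mul_self, mul_assoc, ← mul_assoc (u m), ← mul_assoc b] at this
  · have := mul_mul_mem_closedIdeal (fun n => u n * star (u n)) m (b * star (u m)) (u m * c)
    have e : b * star (u m) * (u m * star (u m)) * (u m * c) = b * E m * c := by
      have h1 := hu.star_mul_eq m
      have h2 := hu.inc.sq m
      linear_combination (norm := noncomm_ring)
        b * h1 * star (u m) * u m * c + b * E m * h1 * c + b * h2 * c
    rwa [e] at this

lemma norm_le (n : ℕ) : ‖u n‖ ≤ 1 := by
  have h1 : ‖u n‖ * ‖u n‖ = ‖E n‖ := by rw [← CStarRing.norm_star_mul_self, hu.star_mul_eq]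
  have h2 := (hu.inc.proj n).norm_le
  nlinarith [norm_nonneg (u n)]

variable [IsRickart A]

lemma mul_isup (n : ℕ) : u n * isup E = u n := by
  rw [← hu.mul_self n, mul_assoc, hu.inc.mul_isup]

variable [PartialOrder A] [StarOrderedRing A]

/-- An element `z` which is formally `a * u` has norm at most `‖a‖`. -/
lemma norm_le_of_mul_eq {a z : A} (hz : z * isup E = z) (h : ∀ n, z * E n = a * u n) :
    ‖z‖ ≤ ‖a‖ := by
  have h1 (n) : z * E n * star z ≤ (‖a‖ ^ 2) • (1 : A) := by
    have e : z * E n * star z = a * (u n * star (u n)) * star a := by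
      have h2 := congrArg star (h n)
      rw [star_mul, star_mul, hu.inc.star_eq] at h2
      have h3 := h n
      have h4 := hu.inc.sq n
      linear_combination (norm := noncomm_ring) a * u n * h2 + h3 * E n * star z - z * h4 * star z
    rw [e]
    have hF := conj_le_conj (hu.star.inc.proj n).le_one a
    rw [mul_one] at hF
    refine hF.trans ?_
    rw [le_smul_one_iff_norm_le (mul_star_self_nonneg a) (by positivity),
      CStarRing.norm_self_mul_star, sq]
  have h2 := hu.inc.conj_isup_le h1
  rw [hz, le_smul_one_iff_norm_le (mul_star_self_nonneg z) (by positivity),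
    CStarRing.norm_self_mul_star, ← sq] at h2
  exact le_of_sq_le_sq h2 (norm_nonneg a)

lemma exists_right_of_mul (m : ℕ) (c : A) :
    ∃ z ∈ closedIdeal E, z * isup E = z ∧ ∀ n, z * E n = E m * c * u n := by
  have hEs := hu.inc.star_eq
  obtain ⟨w, hw, hwg⟩ := exists_extension_of_orthogonal (f := E m)
    (g := fun n => E (m + n) - E m) (z := fun n => E m * c * (u (m + n) - u m)) (M := ‖E m * c‖ * 2)
    (hu.inc.proj m)
    ⟨fun n => isStarProjection_sub (hu.inc.proj _) (hu.inc.proj _) (hu.inc.mul_of_le (by omega)),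
      fun n => by
        have h1 : E (m + (n + 1)) * E (m + n) = E (m + n) := hu.inc.mul_of_le (by omega)
        have h2 : E (m + (n + 1)) * E m = E m := hu.inc.mul_of_le (by omega)
        have h3 : E m * E (m + n) = E m := hu.inc.mul_of_ge (by omega)
        have h4 := hu.inc.sq m
        linear_combination (norm := noncomm_ring) h1 - h2 - h3 + h4⟩
    (fun n => by rw [mul_sub, hu.inc.mul_of_ge (by omega), hu.inc.sq, sub_self])
    (fun n => by rw [mul_assoc, ← mul_assoc, hu.inc.sq])
    (fun n => by
      have h1 : u (m + n) * E (m + n) = u (m + n) := hu.mul_self _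
      have h2 : u m * E (m + n) = u m := hu.mul_of_ge (by omega)
      have h3 : u (m + n) * E m = u m := hu.mul_of_le (by omega)
      have h4 := hu.mul_self m
      linear_combination (norm := noncomm_ring) E m * c * (h1 - h2 - h3 + h4))
    (fun n => by
      have h1 : u (m + (n + 1)) * E (m + n) = u (m + n) := hu.mul_of_le (by omega)
      have h2 : u m * E (m + n) = u m := hu.mul_of_ge (by omega)
      have h3 : u (m + (n + 1)) * E m = u m := hu.mul_of_le (by omega)
      have h4 := hu.mul_self m
      linear_combination (norm := noncomm_ring) E m * c * (h1 - h2 - h3 + h4))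
    (fun n => (norm_mul_le _ _).trans (by
      gcongr
      refine (norm_sub_le _ _).trans ?_
      linarith [hu.norm_le (m + n), hu.norm_le m]))
  have hPm := hu.inc.isup_mul
  refine ⟨(E m * c * u m + w - w * E m) * isup E, ?_, ?_, ?_⟩
  · have : (E m * c * u m + w - w * E m) * isup E
        = 1 * E m * ((E m * c * u m + w - w * E m) * isup E) := by
      have h4 := hu.inc.sq m
      linear_combination (norm := noncomm_ring)
        -h4 * c * u m * isup E - hw * isup E + hw * E m * isup E
    rw [this]
    exact mul_mul_mem_closedIdeal E m _ _
  · rw [mul_assoc, isup_mul_isup]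
  · have key (n : ℕ) : (E m * c * u m + w - w * E m) * isup E * E (m + n)
        = E m * c * u (m + n) := by
      have h2 : u m * E (m + n) = u m := hu.mul_of_ge (by omega)
      have h3 : E m * E (m + n) = E m := hu.inc.mul_of_ge (by omega)
      linear_combination (norm := noncomm_ring) (E m * c * u m + w - w * E m) * hPm (m + n)
        + E m * c * h2 - w * h3 + hwg n
    intro n
    have h1 : E (m + n) * E n = E n := hu.inc.mul_of_le (by omega)
    have h2 : u (m + n) * E n = u n := hu.mul_of_le (by omega)
    rw [← h1, ← mul_assoc, key, mul_assoc, h2]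

lemma exists_right {a : A} (ha : a ∈ closedIdeal E) :
    ∃ z ∈ closedIdeal E, z * isup E = z ∧ ∀ n, z * E n = a * u n := by
  let S : AddSubgroup A :=
    { carrier := {a | ∃ z ∈ closedIdeal E, z * isup E = z ∧ ∀ n, z * E n = a * u n}
      zero_mem' := ⟨0, zero_mem _, by simp, by simp⟩
      add_mem' := by
        rintro a b ⟨z, hz, h1, h2⟩ ⟨y, hy, h3, h4⟩
        exact ⟨z + y, add_mem hz hy, by rw [add_mul, h1, h3], fun n => by
          rw [add_mul, add_mul, h2, h4]⟩
      neg_mem' := by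
        rintro a ⟨z, hz, h1, h2⟩
        exact ⟨-z, neg_mem hz, by rw [neg_mul, h1], fun n => by rw [neg_mul, neg_mul, h2]⟩ }
  suffices h : closedIdeal E ≤ S from h ha
  refine closedIdeal_le (isClosed_of_closure_subset fun a ha => ?_) fun m b c => ?_
  · obtain ⟨x, hx, hxa⟩ := mem_closure_iff_seq_limit.1 ha
    choose z hz h1 h2 using hx
    have hcau : CauchySeq z := by
      have hx := hxa.cauchySeq
      rw [Metric.cauchySeq_iff'] at hx ⊢
      intro ε hε
      obtain ⟨N, hN⟩ := hx ε hε
      refine ⟨N, fun n hn => lt_of_le_of_lt ?_ (hN n hn)⟩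
      rw [dist_eq_norm, dist_eq_norm]
      exact hu.norm_le_of_mul_eq (by rw [sub_mul, h1, h1]) fun k => by
        rw [sub_mul, sub_mul, h2, h2]
    obtain ⟨y, hy⟩ := cauchySeq_tendsto_of_complete hcau
    refine ⟨y, (isClosed_closedIdeal E).mem_of_tendsto hy (.of_forall hz), ?_, fun n => ?_⟩
    · refine tendsto_nhds_unique (hy.mul_const _) ?_
      simpa only [h1] using hy
    · refine tendsto_nhds_unique (hy.mul_const _) ?_
      simpa only [h2] using hxa.mul_const (u n)
  · obtain ⟨z, hz, h1, h2⟩ := hu.exists_right_of_mul m c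
    refine ⟨b * z, mul_mem_closedIdeal_left b hz, by rw [mul_assoc, h1], fun n => ?_⟩
    rw [mul_assoc, h2]; simp only [mul_assoc]

end IsCoherent

end

section

variable {A : Type*} [CStarAlgebra A] [PartialOrder A] [StarOrderedRing A]

lemma add_mul_star_le (X Y : A) :
    (X + Y) * star (X + Y) ≤ (2 : ℝ) • (X * star X) + (2 : ℝ) • (Y * star Y) := by
  have h := mul_star_self_nonneg (X - Y)
  rw [← sub_nonneg]
  convert h using 1
  simp only [star_add, star_sub, two_smul]
  noncomm_ring

lemma conj_proj_mul_le {p : A} (hp : IsStarProjection p) (z b : A) :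
    z * p * b * star (z * p * b) ≤ (‖b‖ ^ 2) • (z * p * star z) := by
  have h1 : b * star b ≤ (‖b‖ ^ 2) • (1 : A) := by
    rw [le_smul_one_iff_norm_le (mul_star_self_nonneg b) (by positivity),
      CStarRing.norm_self_mul_star, sq]
  have h2 := conj_le_conj h1 (z * p)
  have hps : star p = p := hp.isSelfAdjoint
  have hpp : p * p = p := hp.isIdempotentElem
  have e1 : z * p * b * star (z * p * b) = z * p * (b * star b) * star (z * p) := by
    rw [star_mul (z * p) b]; simp only [mul_assoc]
  have e2 : z * p * star (z * p) = z * p * star z := by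
    rw [star_mul, hps, ← mul_assoc, mul_assoc z, hpp]
  rw [mul_smul_comm, smul_mul_assoc, mul_one, e2] at h2
  rwa [e1]

end

namespace IsCoherent

variable {A : Type*} [CStarAlgebra A] [IsRickart A] {E u : ℕ → A} (hu : IsCoherent E u)
include hu

lemma right_unique {z y : A} (hz : z * isup E = z) (hy : y * isup E = y)
    (h : ∀ n, z * E n = y * E n) : z = y := by
  have := hu.inc.mul_isup_eq_zero (y := z - y) fun n => by rw [sub_mul, h, sub_self]
  rwa [sub_mul, hz, hy, sub_eq_zero] at this

variable [PartialOrder A] [StarOrderedRing A]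

lemma exists_left {b : A} (hb : b ∈ closedIdeal E) :
    ∃ l ∈ closedIdeal E, isup (fun n => u n * star (u n)) * l = l ∧
      ∀ n, u n * star (u n) * l = u n * b := by
  obtain ⟨z, hz, h1, h2⟩ := hu.star.exists_right (a := star b) (by
    rw [hu.closedIdeal_range]; exact star_mem_closedIdeal hu.inc.star_eq hb)
  rw [hu.closedIdeal_range] at hz
  refine ⟨star z, star_mem_closedIdeal hu.inc.star_eq hz, ?_, fun n => ?_⟩
  · rw [← star_isup, ← star_mul, h1]
  · have := congrArg star (h2 n)
    simpa using this

/-- The formal products `a * u` and `u * b` are consistent: `(a * u) * b = a * (u * b)`. -/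
lemma consistent {a b z l : A} (hz : z * isup E = z) (hzE : ∀ n, z * E n = a * u n)
    (hl : isup (fun n => u n * star (u n)) * l = l) (hlF : ∀ n, u n * star (u n) * l = u n * b) :
    z * b = a * l := by
  set F : ℕ → A := fun n => u n * star (u n) with hF
  have hFi : IsIncreasing F := hu.star.inc
  set P := isup E with hP
  set Q := isup F with hQ
  set κ : ℝ := 2 * (‖b‖ ^ 2 + ‖l‖ ^ 2) + 1 with hκ
  have hκ0 : 0 < κ := by positivity
  set δ := z * b - a * l with hδ
  have hzaF (n) : z * E n * star z = a * F n * star a := by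
    have h2 := congrArg star (hzE n)
    rw [star_mul, star_mul, hu.inc.star_eq] at h2
    have h4 := hu.inc.sq n
    linear_combination (norm := (simp only [hF]; noncomm_ring))
      a * u n * h2 + hzE n * E n * star z - z * h4 * star z
  have hEP (n) : IsStarProjection (P - E n) :=
    isStarProjection_sub (isStarProjection_isup E) (hu.inc.proj n) (hu.inc.isup_mul n)
  have hFQ (n) : IsStarProjection (Q - F n) :=
    isStarProjection_sub (isStarProjection_isup F) (hFi.proj n) (hFi.isup_mul n)
  have hδn (n) : δ = z * (P - E n) * b + -(a * (Q - F n)) * l := by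
    have h1 : F n * l = u n * b := hlF n
    linear_combination (norm := (simp only [hδ]; noncomm_ring))
      a * hl - hz * b + hzE n * b - a * h1
  have hmain (n) : δ * star δ ≤ κ • (z * (P - E n) * star z + a * (Q - F n) * star a) := by
    have h1 := conj_proj_mul_le (hEP n) z b
    have h2 := conj_proj_mul_le (hFQ n) a l
    have hX := star_right_conjugate_nonneg (hEP n).nonneg z
    have hY := star_right_conjugate_nonneg (hFQ n).nonneg a
    have h3 : δ * star δ ≤ (2 : ℝ) • ((‖b‖ ^ 2) • (z * (P - E n) * star z))
        + (2 : ℝ) • ((‖l‖ ^ 2) • (a * (Q - F n) * star a)) := by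
      have h4 := add_mul_star_le (z * (P - E n) * b) (-(a * (Q - F n)) * l)
      rw [← hδn, neg_mul, star_neg, neg_mul_neg] at h4
      refine h4.trans (add_le_add ?_ ?_)
      · exact smul_le_smul_of_nonneg_left h1 (by norm_num)
      · exact smul_le_smul_of_nonneg_left h2 (by norm_num)
    refine h3.trans ?_
    rw [smul_add, smul_smul, smul_smul]
    refine add_le_add ?_ ?_
    · exact smul_le_smul_of_nonneg_right (by simp only [hκ]; nlinarith [sq_nonneg ‖l‖]) hX
    · exact smul_le_smul_of_nonneg_right (by simp only [hκ]; nlinarith [sq_nonneg ‖b‖]) hY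
  set D := (1 / 2 : ℝ) • (z * P * star z + a * Q * star a - κ⁻¹ • (δ * star δ)) with hD
  have hED (n) : z * E n * star z ≤ D := by
    have h1 := smul_le_smul_of_nonneg_left (hmain n) (inv_nonneg.2 hκ0.le)
    rw [smul_smul, inv_mul_cancel₀ hκ0.ne', one_smul] at h1
    have h2 : (2 : ℝ) • (z * E n * star z) ≤
        z * P * star z + a * Q * star a - κ⁻¹ • (δ * star δ) := by
      rw [← sub_nonneg] at h1 ⊢
      convert h1 using 1
      rw [two_smul]
      nth_rewrite 2 [hzaF]
      noncomm_ring
    have h3 := smul_le_smul_of_nonneg_left h2 (by norm_num : (0 : ℝ) ≤ 1 / 2)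
    rwa [smul_smul, show (1 / 2 : ℝ) * 2 = 1 by norm_num, one_smul] at h3
  have h1 := hu.inc.conj_isup_le hED
  have h2 := hFi.conj_isup_le fun n => (hzaF n).symm.le.trans (hED n)
  have h3 := add_le_add h1 h2
  have h4 : D + D = z * P * star z + a * Q * star a - κ⁻¹ • (δ * star δ) := by
    rw [← two_smul ℝ D, hD, smul_smul]; norm_num
  rw [h4, le_sub_self_iff] at h3
  have h5 : κ⁻¹ • (δ * star δ) = 0 :=
    le_antisymm h3 (smul_nonneg (inv_nonneg.2 hκ0.le) (mul_star_self_nonneg δ))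
  have h6 := (smul_eq_zero.1 h5).resolve_left (inv_ne_zero hκ0.ne')
  exact sub_eq_zero.1 ((CStarRing.mul_star_self_eq_zero_iff _).1 h6)

/-- The maps `a ↦ a * u` of the ideal generated by `E`, where `u` is the formal limit. -/
lemma exists_rightMap : ∃ R : idealSubalgebra E hu.inc.star_eq →L[ℂ]
    idealSubalgebra E hu.inc.star_eq, ∀ a, (R a : A) * isup E = R a ∧
      ∀ n, (R a : A) * E n = a * u n := by
  choose f hf1 hf2 hf3 using fun a : idealSubalgebra E hu.inc.star_eq => hu.exists_right a.2
  refine ⟨LinearMap.mkContinuous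
    { toFun := fun a => ⟨f a, hf1 a⟩
      map_add' := fun a b => Subtype.ext <| hu.right_unique (hf2 _)
        (by simp [add_mul, hf2]) fun n => by simp [add_mul, hf3]
      map_smul' := fun c a => Subtype.ext <| hu.right_unique (hf2 _)
        (by simp [hf2]) fun n => by simp [hf3] } 1 fun a => ?_, fun a => ⟨hf2 a, hf3 a⟩⟩
  rw [one_mul]
  exact hu.norm_le_of_mul_eq (hf2 a) (hf3 a)

/-- The maps `b ↦ u * b` of the ideal generated by `E`, where `u` is the formal limit. -/
lemma exists_leftMap : ∃ L : idealSubalgebra E hu.inc.star_eq →L[ℂ]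
    idealSubalgebra E hu.inc.star_eq, ∀ b, isup (fun n => u n * star (u n)) * (L b : A) = L b ∧
      ∀ n, u n * star (u n) * (L b : A) = u n * b := by
  set F : ℕ → A := fun n => u n * star (u n) with hF
  have hFi : IsIncreasing F := hu.star.inc
  choose f hf1 hf2 hf3 using fun a : idealSubalgebra E hu.inc.star_eq => hu.exists_left a.2
  have huniq {y z : A} (hy : isup F * y = y) (hz : isup F * z = z) (h : ∀ n, F n * y = F n * z) :
      y = z := by
    have := hFi.isup_mul_eq_zero (y := y - z) fun n => by rw [mul_sub, h, sub_self]
    rwa [mul_sub, hz, hy, sub_eq_zero] at this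
  refine ⟨LinearMap.mkContinuous
    { toFun := fun a => ⟨f a, hf1 a⟩
      map_add' := fun a b => Subtype.ext <| huniq (hf2 _)
        (by simp [mul_add, hf2, hF]) fun n => by simp [mul_add, hf3, hF]
      map_smul' := fun c a => Subtype.ext <| huniq (hf2 _)
        (by simp [hf2, hF]) fun n => by simp [hf3, hF] } 1 fun a => ?_, fun a => ⟨hf2 a, hf3 a⟩⟩
  rw [one_mul]
  have h := hu.star.norm_le_of_mul_eq (a := star (a : A)) (z := star (f a))
    (by rw [← star_isup, ← star_mul, hf2])
    (fun n => by rw [← hu.star.inc.star_eq, ← star_mul, hf3, star_mul])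
  simpa using h

/-- Partial isometries in a Rickart C⋆-algebra are countably addable. -/
theorem exists_mul_eq : ∃ v : A, ∀ n, v * E n = u n := by
  set F : ℕ → A := fun n => u n * star (u n) with hF
  have hFi : IsIncreasing F := hu.star.inc
  have : IsClosed (idealSubalgebra E hu.inc.star_eq : Set A) := isClosed_closedIdeal E
  obtain ⟨R, hR⟩ := hu.exists_rightMap
  obtain ⟨L, hL⟩ := hu.exists_leftMap
  let w : DoubleCentralizer ℂ (idealSubalgebra E hu.inc.star_eq) :=
    ⟨(L, R), fun a b => Subtype.ext
      (hu.consistent (hR a).1 (hR a).2 (hL b).1 (hL b).2)⟩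
  have hfr := hu.inc.isFrame_diff
  have hmem : wsum (diff E) ∈ idealSubalgebra E hu.inc.star_eq := by
    refine tsum_mem (f := fun k => (1 / 2 : ℝ) ^ k • diff E k)
      (s := idealSubalgebra E hu.inc.star_eq) (isClosed_closedIdeal E) fun k => ?_
    have := mul_mul_mem_closedIdeal E k ((1 / 2 : ℝ) ^ k • 1) (diff E k)
    rwa [smul_mul_assoc, one_mul, smul_mul_assoc, hu.inc.mul_diff le_rfl] at this
  set h : idealSubalgebra E hu.inc.star_eq := ⟨wsum (diff E), hmem⟩ with hh
  obtain ⟨a, ha⟩ := RickartPolar.exists_mul_eq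
    (NonUnitalStarSubalgebraClass.subtype (idealSubalgebra E hu.inc.star_eq)) (h := h)
    (Subtype.ext hfr.star_wsum) w
  replace ha : a * wsum (diff E) = L h := ha
  have hP : isup E = lp (wsum (diff E)) := rfl
  have h1 (n) : F n * a * isup E = u n := by
    have h2 : (F n * a - u n) * wsum (diff E) = 0 := by
      rw [sub_mul, mul_assoc, ha, (hL h).2, sub_self]
    have h3 := mul_lp h2
    rw [← hP, sub_mul, sub_eq_zero, hu.mul_isup] at h3
    exact h3
  have h2 : isup F * a * isup E = a * isup E := by
    have h2 : (isup F * a - a) * wsum (diff E) = 0 := by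
      rw [sub_mul, mul_assoc, ha, (hL h).1, sub_self]
    have h3 := mul_lp h2
    rwa [← hP, sub_mul, sub_eq_zero] at h3
  refine ⟨a * isup E, fun m => ?_⟩
  have h3 : isup F * (a * isup E * E m - u m) = 0 := by
    refine hFi.isup_mul_eq_zero fun n => ?_
    have h4 (k) (hk : m ≤ k) : F k * (a * isup E * E m - u m) = 0 := by
      rw [mul_sub, hu.range_mul_of_le hk, ← mul_assoc, ← mul_assoc, h1, hu.mul_of_le hk, sub_self]
    rw [← hFi.mul_of_ge (le_max_left n m), mul_assoc, h4 _ (le_max_right n m), mul_zero]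
  have h5 : isup F * u m = u m := by
    have := hFi.isup_mul m
    rw [← hu.range_mul_of_le (le_refl m), ← mul_assoc, this]
  rwa [mul_sub, h5, ← mul_assoc, ← mul_assoc, h2, sub_eq_zero] at h3

end IsCoherent

section

variable {A : Type*} [CStarAlgebra A] [PartialOrder A] [StarOrderedRing A]

/-- The parts of a positive element `h` above and below the level `δ`. -/
lemma exists_cut {h : A} (hh : 0 ≤ h) (δ : ℝ) :
    ∃ m : A, star m = m ∧ cfc (fun t : ℝ => max (t - δ) 0) h - m = h - δ • 1 ∧
      cfc (fun t : ℝ => max (t - δ) 0) h * m = 0 := by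
  have hsa : IsSelfAdjoint h := hh.isSelfAdjoint
  refine ⟨cfc (fun t : ℝ => max (δ - t) 0) h,
    (cfc_predicate (p := IsSelfAdjoint) (R := ℝ) _ h).star_eq, ?_, ?_⟩
  · rw [← cfc_sub .., ← Algebra.algebraMap_eq_smul_one]
    conv_rhs => rw [← cfc_id ℝ h, ← cfc_const δ h, ← cfc_sub ..]
    refine cfc_congr fun t _ => ?_
    rcases le_total t δ with ht | ht
    · simp only [id]
      rw [max_eq_right (by linarith), max_eq_left (by linarith)]; ring
    · simp only [id]
      rw [max_eq_left (by linarith), max_eq_right (by linarith)]; ring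
  · rw [← cfc_mul .., ← cfc_zero ℝ h]
    refine cfc_congr fun t _ => ?_
    rcases le_total t δ with ht | ht
    · simp [max_eq_right (sub_nonpos.2 ht)]
    · simp [max_eq_right (sub_nonpos.2 ht)]

lemma norm_sub_cut_le {h : A} (hh : 0 ≤ h) {δ : ℝ} (hδ : 0 ≤ δ) :
    ‖h - cfc (fun t : ℝ => max (t - δ) 0) h‖ ≤ δ := by
  have hsa : IsSelfAdjoint h := hh.isSelfAdjoint
  have : h - cfc (fun t : ℝ => max (t - δ) 0) h = cfc (fun t : ℝ => t - max (t - δ) 0) h := by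
    rw [cfc_sub .., cfc_id' ℝ h]
  rw [this]
  refine norm_cfc_le hδ fun t ht => ?_
  have ht0 : 0 ≤ t := spectrum_nonneg_of_nonneg hh ht
  rw [Real.norm_eq_abs, abs_le]
  rcases le_total t δ with h1 | h1
  · rw [max_eq_right (by linarith)]; constructor <;> linarith
  · rw [max_eq_left (by linarith)]; constructor <;> linarith

variable [IsRickart A]

/-- Over the spectral projection of `h` above a positive level, `h` is invertible. -/
lemma exists_inv_cut {h : A} (hh : 0 ≤ h) {δ : ℝ} (hδ : 0 < δ) :
    ∃ k : A, star k = k ∧ h * k = lp (cfc (fun t : ℝ => max (t - δ) 0) h) ∧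
      k * h = lp (cfc (fun t : ℝ => max (t - δ) 0) h) ∧
      lp (cfc (fun t : ℝ => max (t - δ) 0) h) * k = k := by
  have hsa : IsSelfAdjoint h := hh.isSelfAdjoint
  obtain ⟨m, hms, hpm, hpm0⟩ := exists_cut hh δ
  set p := cfc (fun t : ℝ => max (t - δ) 0) h with hp
  set E := lp p with hE
  have hp0 : 0 ≤ p := cfc_nonneg fun t _ => le_max_right _ _
  have hps : star p = p := hp0.isSelfAdjoint
  have hEs : star E = E := star_lp p
  have hEE : E * E = E := lp_mul_lp p
  have hEp : E * p = p := lp_mul p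
  have hpE : p * E = p := mul_eq_of_mul_eq hps hEs hEp
  have hEm : E * m = 0 := lp_mul_eq_zero (by rw [hps, hpm0])
  have hmE : m * E = 0 := mul_eq_zero_symm hEs hms hEm
  obtain ⟨K, hK1, hK2, hKs⟩ := exists_inv_one_add (a := δ⁻¹ • p)
    (smul_nonneg (inv_nonneg.2 hδ.le) hp0)
  have hh' : h = p - m + δ • 1 := by rw [hpm]; abel
  have hc : δ • (1 + δ⁻¹ • p) = p + δ • (1 : A) := by
    rw [smul_add, smul_smul, mul_inv_cancel₀ hδ.ne', one_smul, add_comm]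
  have hEh : E * h = E * (p + δ • (1 : A)) := by
    rw [hh', mul_add, mul_sub, hEm, sub_zero, ← mul_add]
  have hhE : h * E = (p + δ • (1 : A)) * E := by
    rw [hh', add_mul, sub_mul, hmE, sub_zero, ← add_mul]
  have hcomm : E * (p + δ • (1 : A)) = (p + δ • (1 : A)) * E := by
    rw [mul_add, add_mul, hEp, hpE]; simp
  have hL : (δ⁻¹ • K) * (p + δ • (1 : A)) = 1 := by
    rw [← hc, smul_mul_smul_comm, hK1, inv_mul_cancel₀ hδ.ne', one_smul]
  have hR : (p + δ • (1 : A)) * (δ⁻¹ • K) = 1 := by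
    rw [← hc, smul_mul_smul_comm, hK2, mul_inv_cancel₀ hδ.ne', one_smul]
  have hKEs : star (δ⁻¹ • K) = δ⁻¹ • K := by rw [star_smul, hKs]; simp
  set L := δ⁻¹ • K with hLdef
  set c := p + δ • (1 : A) with hcdef
  have hEL : E * L = L * E := by
    linear_combination (norm := noncomm_ring) -hL * E * L + L * E * hR - L * hcomm * L
  refine ⟨E * L, by rw [star_mul, hEs, hKEs, hEL], ?_, ?_, ?_⟩
  · rw [← mul_assoc, hhE, ← hcomm, mul_assoc, hR, mul_one]
  · rw [hEL, mul_assoc, hEh, hcomm, ← mul_assoc, hL, one_mul]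
  · rw [← mul_assoc, hEE]

/-- Polar decomposition in unital Rickart C⋆-algebras. -/
theorem exists_polar (x : A) : ∃ v : A, star v * v = lp (CFC.abs x) ∧ v * CFC.abs x = x ∧
    v * lp (CFC.abs x) = v := by
  set h := CFC.abs x with hhdef
  have hh : 0 ≤ h := CFC.abs_nonneg x
  have hhs : star h = h := hh.isSelfAdjoint
  have hhh : h * h = star x * x := CFC.abs_mul_abs x
  have hsa : IsSelfAdjoint h := hhs
  set δ : ℕ → ℝ := fun n => 1 / ((n : ℝ) + 1) with hδdef
  have hδ (n) : 0 < δ n := by simp only [hδdef]; positivity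
  set p : ℕ → A := fun n => cfc (fun t : ℝ => max (t - δ n) 0) h with hp
  have hp0 (n) : 0 ≤ p n := cfc_nonneg fun t _ => le_max_right _ _
  choose k hks hhk hkh hEk using fun n => exists_inv_cut hh (hδ n)
  set E : ℕ → A := fun n => lp (p n) with hEdef
  have hEs (n) : star (E n) = E n := star_lp _
  have hEE (n) : E n * E n = E n := lp_mul_lp _
  replace hhk (n) : h * k n = E n := hhk n
  replace hkh (n) : k n * h = E n := hkh n
  replace hEk (n) : E n * k n = k n := hEk n
  have hkE (n) : k n * E n = k n := mul_eq_of_mul_eq (hks n) (hEs n) (hEk n)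
  have hEi : IsIncreasing E := by
    refine ⟨fun n => isStarProjection_lp _, fun n => mul_lp_eq_of_mul_eq ?_⟩
    obtain ⟨m, hms, -, hm0⟩ := exists_cut hh (δ (n + 1))
    have hle : p n ≤ p (n + 1) := by
      refine cfc_mono fun t _ => max_le_max_right 0 (sub_le_sub_left ?_ t)
      exact one_div_le_one_div_of_le (by positivity) (by push_cast; linarith)
    have h1 : (1 - E (n + 1)) * p n * star (1 - E (n + 1)) ≤
        (1 - E (n + 1)) * p (n + 1) * star (1 - E (n + 1)) := conj_le_conj hle _
    have h2 : (1 - E (n + 1)) * p (n + 1) = 0 := by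
      rw [sub_mul, one_mul, hEdef]; simp only [lp_mul, sub_self]
    rw [h2, zero_mul] at h1
    have h3 := le_antisymm h1 (star_right_conjugate_nonneg (hp0 n) _)
    have h4 : (1 - E (n + 1)) * p n = 0 := by
      have hsq := CFC.sqrt_mul_sqrt_self (p n) (hp0 n)
      have hsqs : star (CFC.sqrt (p n)) = CFC.sqrt (p n) := (CFC.sqrt_nonneg _).isSelfAdjoint
      rw [← hsq] at h3 ⊢
      have h5 : (1 - E (n + 1)) * CFC.sqrt (p n) = 0 := by
        rw [← CStarRing.mul_star_self_eq_zero_iff, star_mul, hsqs]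
        simpa only [mul_assoc] using h3
      rw [← mul_assoc, h5, zero_mul]
    rwa [sub_mul, one_mul, sub_eq_zero, eq_comm] at h4
  have hEh (n) : E n * h = h * E n := by
    rw [← hhk, mul_assoc, hkh, hhk]
  have hsup : isup E * h = h := by
    have h1 (n) : ‖isup E * h - h‖ ≤ 2 * δ n := by
      have e : isup E * h - h = isup E * (h - p n) - (h - p n) := by
        have h2 : E n * p n = p n := lp_mul _
        linear_combination (norm := noncomm_ring) hEi.isup_mul n * p n - isup E * h2 + h2
      have h3 := norm_sub_cut_le hh (hδ n).le
      have h4 := (isStarProjection_isup E).norm_le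
      rw [e]
      refine (norm_sub_le _ _).trans ?_
      have h5 := norm_mul_le (isup E) (h - p n)
      have h6 : ‖h - p n‖ ≤ δ n := h3
      nlinarith [norm_nonneg (h - p n)]
    have h2 : ‖isup E * h - h‖ ≤ 2 * 0 :=
      ge_of_tendsto' (tendsto_one_div_add_atTop_nhds_zero_nat.const_mul (2 : ℝ)) h1
    rw [mul_zero] at h2
    exact sub_eq_zero.1 (norm_le_zero_iff.1 h2)
  have hP : isup E = lp h := by
    have h1 : lp h * isup E = isup E := hEi.isup_mul_eq fun n => by
      rw [← hhk, ← mul_assoc, lp_mul]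
    rw [← lp_mul_eq_of_mul_eq (isStarProjection_isup E) hsup, h1]
  have hu : IsCoherent E fun n => x * k n := by
    refine ⟨hEi, fun n => ?_, fun n => ?_⟩
    · rw [star_mul, hks]
      linear_combination (norm := noncomm_ring) -k n * hhh * k n + hkh n * (h * k n)
        + E n * hhk n + hEE n
    · rw [mul_assoc]
      have h1 : k (n + 1) * E n = k n := by
        rw [← hhk n, ← mul_assoc, hkh, ← hEk n, ← mul_assoc, hEi.succ]
      rw [h1]
  obtain ⟨v, hv⟩ := hu.exists_mul_eq
  have hPE := hEi.isup_mul
  have hPP := isup_mul_isup E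
  have hPs := star_isup E
  have hEvv (m n : ℕ) : E m * (star v * v) * E n = E m * E n := by
    have e : E m * (star v * v) * E n = star (v * E m) * (v * E n) := by
      rw [star_mul, hEs]; simp only [mul_assoc]
    rw [e, hv, hv]
    rcases le_total m n with hmn | hmn
    · have h1 := congrArg star (hu.star_mul_of_le hmn)
      rw [star_mul, star_star] at h1
      rw [h1, hEs, hEi.mul_of_ge hmn]
    · rw [hu.star_mul_of_le hmn, hEi.mul_of_le hmn]
  refine ⟨v * isup E, ?_, ?_, ?_⟩
  · rw [star_mul, hPs, ← hP]
    have h1 (n) : isup E * ((star v * v - 1) * E n) = 0 :=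
      hEi.isup_mul_eq_zero fun m => by
        linear_combination (norm := noncomm_ring) hEvv m n
    have h2 : isup E * (star v * v - 1) * isup E = 0 :=
      hEi.mul_isup_eq_zero fun n => by rw [mul_assoc, h1]
    linear_combination (norm := noncomm_ring) h2 + hPP
  · have hhP : h * isup E = h := mul_eq_of_mul_eq hhs hPs hsup
    have hxP : x * isup E = x := by
      have h1 : x * (1 - isup E) = 0 := abs_mul_eq_zero_iff.1 (by
        rw [← hhdef, mul_sub, hhP, mul_one, sub_self])
      rw [mul_sub, mul_one, sub_eq_zero] at h1
      exact h1.symm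
    have h1 : (v * h - x) * isup E = 0 := hEi.mul_isup_eq_zero fun n => by
      linear_combination (norm := noncomm_ring) -v * hEh n + hv n * h + x * hkh n
    rw [mul_assoc, hsup]
    rwa [sub_mul, mul_assoc, hhP, hxP, sub_eq_zero] at h1
  · rw [mul_assoc, ← hP, hPP]

end

section

open scoped CStarAlgebra

lemma eq_inr_of_fst_eq_zero {A : Type*} [AddZeroClass A] {y : A⁺¹} (h : y.fst = 0) :
    ((y.snd : A) : A⁺¹) = y :=
  Unitization.ext (by simp [h]) (by simp)

variable {A : Type*} [NonUnitalCStarAlgebra A]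

/-- A weakly Rickart C⋆-algebra contains left projections of its elements, also relative to its
unitization. -/
lemma exists_leftProj_inr (hA : WeaklyRickart A) (a : A) :
    ∃ p : A, star p = p ∧ p * p = p ∧ p * a = a ∧
      ∀ y : A⁺¹, y * (a : A⁺¹) = 0 → y * (p : A⁺¹) = 0 := by
  obtain ⟨p, ⟨hps, hpp⟩, hap, hp⟩ := hA (star a)
  refine ⟨p, hps, hpp, by rw [← star_star a, ← star_star p, ← star_mul, hps, hap], fun y hy => ?_⟩
  have key (c : A⁺¹) (hc : c.fst = 0) : c * y * (p : A⁺¹) = 0 := by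
    have h1 : ((c * y).snd : A⁺¹) = c * y := eq_inr_of_fst_eq_zero (by simp [hc])
    set d := (c * y).snd with hd
    rw [← h1]
    have h2 : d * a = 0 := by
      apply Unitization.inr_injective (R := ℂ)
      rw [Unitization.inr_mul, h1, mul_assoc, hy, mul_zero, Unitization.inr_zero]
    have h3 := hp (star d) (by rw [← star_mul, h2, star_zero])
    have h4 : d * p = 0 := by
      rw [← star_star d, ← star_star p, ← star_mul, hps, h3, star_zero]
    rw [← Unitization.inr_mul, h4, Unitization.inr_zero]
  have h := key (star (y * (p : A⁺¹))) (by simp)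
  rw [mul_assoc] at h
  exact (CStarRing.star_mul_self_eq_zero_iff _).1 h

/-- The unitization of a weakly Rickart C⋆-algebra is a Rickart C⋆-algebra. -/
lemma isRickart_unitization (hA : WeaklyRickart A) : IsRickart A⁺¹ := by
  refine ⟨fun X => ?_⟩
  by_cases hX : X.fst = 0
  · obtain ⟨p, hps, hpp, hpa, hp⟩ := exists_leftProj_inr hA X.snd
    rw [eq_inr_of_fst_eq_zero hX] at hp
    refine ⟨p, ⟨?_, ?_⟩, ?_, hp⟩
    · rw [IsIdempotentElem, ← Unitization.inr_mul, hpp]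
    · rw [IsSelfAdjoint, ← Unitization.inr_star, hps]
    · rw [← eq_inr_of_fst_eq_zero hX, ← Unitization.inr_mul, hpa]
  · set H := X * star X with hH
    set μ : ℂ := H.fst with hμ
    have hμ0 : μ ≠ 0 := by simp [hμ, hH, hX]
    set a := H.snd with ha
    have hHa : H = μ • (1 : A⁺¹) + (a : A⁺¹) := by
      refine Unitization.ext (by simp [hμ]) (by simp [ha])
    have has : star a = a := by simp [ha, hH, ← Unitization.snd_star, add_comm]
    obtain ⟨e, hes, hee, hea, -⟩ := exists_leftProj_inr hA a
    have hae : a * e = a := mul_eq_of_mul_eq has hes hea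
    obtain ⟨r, hrs, hrr, hrx, hr⟩ := exists_leftProj_inr hA (μ • e + a)
    have her : e * r = r := by
      have := hr ((e : A⁺¹) - 1) (by
        rw [sub_mul, one_mul, ← Unitization.inr_mul, mul_add, mul_smul_comm, hee, hea, sub_self])
      rw [sub_mul, one_mul, sub_eq_zero, ← Unitization.inr_mul] at this
      exact Unitization.inr_injective this
    have hre : r * e = r := mul_eq_of_mul_eq hrs hes her
    have c1 : (e : A⁺¹) * e = e := by rw [← Unitization.inr_mul, hee]
    have c2 : (e : A⁺¹) * r = r := by rw [← Unitization.inr_mul, her]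
    have c3 : (r : A⁺¹) * e = r := by rw [← Unitization.inr_mul, hre]
    have c4 : (r : A⁺¹) * r = r := by rw [← Unitization.inr_mul, hrr]
    have c5 : (e : A⁺¹) * a = a := by rw [← Unitization.inr_mul, hea]
    have c6 : (a : A⁺¹) * e = a := by rw [← Unitization.inr_mul, hae]
    have c7 : (r : A⁺¹) * (μ • (e : A⁺¹) + a) = μ • (e : A⁺¹) + a := by
      rw [← Unitization.inr_smul, ← Unitization.inr_add, ← Unitization.inr_mul, hrx]
    rw [Unitization.inr_add, Unitization.inr_smul] at hr
    set e' : A⁺¹ := (e : A⁺¹) with he'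
    set r' : A⁺¹ := (r : A⁺¹) with hr'
    set a' : A⁺¹ := (a : A⁺¹) with ha'
    have hes' : star e' = e' := by rw [he', ← Unitization.inr_star, hes]
    have hrs' : star r' = r' := by rw [hr', ← Unitization.inr_star, hrs]
    have hpH : (1 - e' + r') * H = H := by
      have hs1 : r' * (μ • e') = μ • r' := by rw [mul_smul_comm, c3]
      have hs2 : r' * (μ • (1 : A⁺¹)) = μ • r' := by simp
      have hs3 : e' * (μ • (1 : A⁺¹)) = μ • e' := by simp
      rw [hHa]
      generalize μ • (1 : A⁺¹) = g, μ • e' = ge, μ • r' = gr at *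
      linear_combination (norm := noncomm_ring) c7 - c5 - hs1 + hs2 - hs3
    refine ⟨1 - e' + r', ⟨?_, ?_⟩, ?_, fun Y hY => ?_⟩
    · rw [IsIdempotentElem]
      linear_combination (norm := noncomm_ring) c1 - c2 - c3 + c4
    · rw [IsSelfAdjoint, star_add, star_sub, star_one, hes', hrs']
    · rw [← sub_eq_zero, ← CStarRing.mul_star_self_eq_zero_iff]
      have h1 : (1 - e' + r') * X - X = (1 - e' + r' - 1) * X := by rw [sub_mul, one_mul]
      have h2 : (1 - e' + r' - 1) * H = 0 := by rw [sub_mul, hpH, one_mul, sub_self]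
      rw [h1, star_mul, mul_assoc, ← mul_assoc X, ← hH, ← mul_assoc, h2, zero_mul]
    · have hYH : Y * H = 0 := by rw [hH, ← mul_assoc, hY, zero_mul]
      rw [hHa] at hYH
      have h1 : Y * (μ • e' + a') = 0 := by
        have : (μ • (1 : A⁺¹) + a') * e' = μ • e' + a' := by
          rw [add_mul, c6, smul_mul_assoc, one_mul]
        rw [← this, ← mul_assoc, hYH, zero_mul]
      have h2 := hr Y h1
      have h3 : μ • (Y * (1 - e')) = 0 := by
        have : (μ • (1 : A⁺¹) + a') * (1 - e') = μ • (1 - e') := by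
          rw [mul_sub, mul_one, add_mul, c6, smul_mul_assoc, one_mul, smul_sub]; abel
        rw [← mul_smul_comm, ← this, ← mul_assoc, hYH, zero_mul]
      rw [mul_add, h2, (smul_eq_zero.1 h3).resolve_left hμ0, add_zero]

lemma mul_star_mul_self_of_isPartialIsometry {e : A} (he : IsPartialIsometry e) :
    e * star e * e = e := by
  have hee : e * star e * (e * star e) = e * star e := he.2
  rw [← sub_eq_zero, ← CStarRing.mul_star_self_eq_zero_iff]
  have h1 : star (e * star e * e - e) = star e * (e * star e) - star e := by
    simp only [star_sub, star_mul, star_star]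
  have h2 : e * star e * e * (star e * (e * star e)) = e * star e := by
    rw [← mul_assoc, mul_assoc (e * star e), hee, hee]
  have h3 : e * (star e * (e * star e)) = e * star e := by rw [← mul_assoc, hee]
  have h4 : e * star e * e * star e = e * star e := by rw [mul_assoc, hee]
  rw [h1, sub_mul, mul_sub, mul_sub, h2, h3, h4, sub_self]

lemma range_mul_eq_zero_iff {e : A} (hee : e * star e * e = e) (y : A) :
    e * star e * y = 0 ↔ star y * e = 0 := by
  rw [← star_eq_zero, star_mul, star_mul, star_star]
  refine ⟨fun h => ?_, fun h => by rw [← mul_assoc, h, zero_mul]⟩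
  rw [← hee, ← mul_assoc, h, zero_mul]

lemma mul_source_eq_zero_iff {e : A} (hee : e * star e * e = e) (y : A) :
    y * (star e * e) = 0 ↔ e * star y = 0 := by
  rw [← star_eq_zero, star_mul, star_mul, star_star]
  refine ⟨fun h => ?_, fun h => by rw [mul_assoc, h, mul_zero]⟩
  rw [← hee, mul_assoc, mul_assoc, ← mul_assoc (star e), h, mul_zero]

variable [PartialOrder A] [StarOrderedRing A]

/-- Polar decomposition in weakly Rickart C⋆-algebras. -/
theorem WeaklyRickart.exists_polar (hA : WeaklyRickart A) (x : A) :
    ∃ e : A, e * star e * e = e ∧ e * star e * x = x ∧ x * (star e * e) = x ∧ 0 ≤ star e * x ∧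
      (∀ y : A, y * e = 0 ↔ y * x = 0) ∧ (∀ y : A, e * y = 0 ↔ x * y = 0) := by
  have := isRickart_unitization hA
  obtain ⟨v, hvv, hvx, hvP⟩ := RickartPolar.exists_polar (x : A⁺¹)
  set h := CFC.abs (x : A⁺¹) with hh
  set P := lp h with hP
  have hhs : star h = h := (CFC.abs_nonneg _).isSelfAdjoint
  have hPs : star P = P := star_lp h
  have hPh : P * h = h := lp_mul h
  have hhP : h * P = h := mul_eq_of_mul_eq hhs hPs hPh
  obtain ⟨p, ⟨hps, hpp⟩, hxp, -⟩ := hA x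
  have hps' : star (p : A⁺¹) = p := by rw [← Unitization.inr_star, hps]
  have hpP : (p : A⁺¹) * P = P := mul_lp_eq_of_mul_eq (by
    have h1 : h * (1 - (p : A⁺¹)) = 0 := abs_mul_eq_zero_iff.2 (by
      rw [mul_sub, mul_one, ← Unitization.inr_mul, hxp, sub_self])
    rw [mul_sub, mul_one, sub_eq_zero] at h1
    have h2 := congrArg star h1
    rwa [star_mul, hhs, hps', eq_comm] at h2)
  have hPp : P * (p : A⁺¹) = P := mul_eq_of_mul_eq hPs hps' hpP
  have hv : ((v.snd : A) : A⁺¹) = v := eq_inr_of_fst_eq_zero (by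
    rw [← hvP, ← hPp, ← mul_assoc]; simp)
  set e := v.snd with he
  have hsv : ((star e : A) : A⁺¹) = star v := by rw [Unitization.inr_star, hv]
  have hsvx : star v * (x : A⁺¹) = h := by rw [← hvx, ← mul_assoc, hvv, hPh]
  have hinj := Unitization.inr_injective (R := ℂ) (A := A)
  have hxe : x * (star e * e) = x := hinj (by
    rw [Unitization.inr_mul, Unitization.inr_mul, hsv, hv, hvv, ← hvx, mul_assoc, hhP])
  have hee : e * star e * e = e := hinj (by
    rw [Unitization.inr_mul, Unitization.inr_mul, hsv, hv, mul_assoc, hvv, hvP])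
  have hex : e * star e * x = x := hinj (by
    rw [Unitization.inr_mul, Unitization.inr_mul, hsv, hv, mul_assoc, hsvx, hvx])
  refine ⟨e, hee, hex, hxe, ?_, fun y => ⟨fun hy => ?_, fun hy => ?_⟩,
    fun y => ⟨fun hy => ?_, fun hy => ?_⟩⟩
  · rw [← Unitization.inr_nonneg_iff, Unitization.inr_mul, hsv, hsvx]
    exact CFC.abs_nonneg _
  · rw [← hex, ← mul_assoc, ← mul_assoc, hy, zero_mul, zero_mul]
  · apply hinj
    have h1 : (y : A⁺¹) * v * h = 0 := by
      rw [mul_assoc, hvx, ← Unitization.inr_mul, hy, Unitization.inr_zero]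
    have h2 := mul_lp h1
    rw [← hP, mul_assoc, hvP] at h2
    rw [Unitization.inr_mul, hv, h2, Unitization.inr_zero]
  · rw [← hxe, mul_assoc, mul_assoc, hy, mul_zero, mul_zero]
  · apply hinj
    have h1 : h * (y : A⁺¹) = 0 := abs_mul_eq_zero_iff.2 (by
      rw [← Unitization.inr_mul, hy, Unitization.inr_zero])
    have h2 : P * (y : A⁺¹) = 0 := lp_mul_eq_zero (by rw [hhs, h1])
    rw [Unitization.inr_mul, hv, ← hvP, mul_assoc, h2, mul_zero, Unitization.inr_zero]

end

end RickartPolar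

/-- A C*-algebra `A` is weakly Rickart if, and only if, for every `x ∈ A` there exists a
partial isometry `e ∈ A` such that `A(x) ⊆ A₂(e)`, `x` is a positive element of the
C*-algebra `(A₂(e), •_e, *_e)` (equivalently, `x ∈ A₂(e)` and `e* x` is positive in `A`),
and `A₀(e) = {x}^⊥`. -/
theorem weaklyRickart_iff_range_partial_isometry {A : Type*} [NonUnitalCStarAlgebra A]
    [PartialOrder A] [StarOrderedRing A] :
    WeaklyRickart A ↔
      ∀ x : A, ∃ e : A, IsPartialIsometry e ∧
        innerIdealGen x ⊆ Peirce2 e ∧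
        (x ∈ Peirce2 e ∧ 0 ≤ star e * x) ∧
        Peirce0 e = orthAnnihilator x := by
  constructor
  · intro hA x
    obtain ⟨e, hee, hex, hxe, hpos, hle, hri⟩ := RickartPolar.WeaklyRickart.exists_polar hA x
    refine ⟨e, ⟨by rw [star_mul, star_star], by rw [← mul_assoc, hee]⟩, ?_, ⟨?_, hpos⟩, ?_⟩
    · refine closure_minimal ?_ (isClosed_eq (by fun_prop) continuous_id)
      rintro _ ⟨a, rfl⟩
      change e * star e * (x * a * x) * (star e * e) = x * a * x
      rw [mul_assoc, mul_assoc (x * a), hxe, ← mul_assoc, ← mul_assoc, hex]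
    · change e * star e * x * (star e * e) = x
      rw [hex, hxe]
    · ext y
      change (e * star e * y = 0 ∧ y * (star e * e) = 0) ↔ (x * star y = 0 ∧ star y * x = 0)
      rw [RickartPolar.range_mul_eq_zero_iff hee, RickartPolar.mul_source_eq_zero_iff hee,
        hle, hri, and_comm]
  · intro H x
    obtain ⟨e, he, -, ⟨hx, -⟩, h0⟩ := H (star x * x)
    replace hx : e * star e * (star x * x) * (star e * e) = star x * x := hx
    have hee := RickartPolar.mul_star_mul_self_of_isPartialIsometry he
    have hpp : star e * e * (star e * e) = star e * e := by
      rw [mul_assoc, ← mul_assoc e, hee]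
    have hps : star (star e * e) = star e * e := by rw [star_mul, star_star]
    have hxp : star x * x * (star e * e) = star x * x := by
      rw [← hx, mul_assoc, hpp]
    refine ⟨star e * e, ⟨hps, hpp⟩, ?_, fun y hy => ?_⟩
    · rw [← sub_eq_zero, ← CStarRing.star_mul_self_eq_zero_iff]
      have h1 : star x * (x * (star e * e) - x) = 0 := by
        rw [mul_sub, ← mul_assoc, hxp, sub_self]
      rw [star_sub, star_mul, sub_mul, mul_assoc, h1, mul_zero, sub_self]
    · have hmem : y * star y ∈ orthAnnihilator (star x * x) := by
        have h1 : star x * x * (y * star y) = 0 := by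
          rw [mul_assoc, ← mul_assoc x, hy, zero_mul, mul_zero]
        have h2 := congrArg star h1
        simp only [star_mul, star_star, star_zero] at h2
        refine ⟨?_, ?_⟩ <;> rw [star_mul, star_star]
        · exact h1
        · exact h2
      rw [← h0] at hmem
      have h1 : y * star y * (star e * e) = 0 := hmem.2
      rw [← CStarRing.mul_star_self_eq_zero_iff, star_mul, hps, mul_assoc, ← mul_assoc y, h1,
        mul_zero]
end

section
/- Let x be an element of a weakly Rickart C*-algebra A and let e ∈ A be a partial isometry. Then the following are equivalent: (a) e is the partial isometry in the polar decomposition of x, i.e. x = e (x* x)^{1/2}, e e* = LP(x) and e* e = RP(x); (b) x is a positive element of the C*-algebra (A₂(e), •_e, *_e) (equivalently, x ∈ A₂(e) and e* x is positive in A), and A₀(e) = {x}^⊥. -/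
/-- `q` is an annihilating left projection (ALP) of `x`. -/
def IsALP {A : Type*} [Mul A] [Star A] [Zero A] (x q : A) : Prop :=
  IsProjection q ∧ q * x = x ∧ ∀ y : A, y * x = 0 → y * q = 0

/-- In a C*-algebra, a partial isometry `e` satisfies `e * e* * e = e`. -/
theorem IsPartialIsometry.mul_star_mul_self {A : Type*} [NonUnitalCStarAlgebra A] {e : A}
    (he : IsPartialIsometry e) : e * star e * e = e := by
  have h2 : e * star e * (e * star e) = e * star e := he.2
  have h : (e * star e * e - e) * star (e * star e * e - e) = 0 := by
    have h3 : e * (star e * (e * star e)) = e * star e := by simpa only [mul_assoc] using h2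
    simp only [star_sub, star_mul, star_star, sub_mul, mul_sub, mul_assoc, h3, sub_self]
  exact sub_eq_zero.mp (CStarRing.mul_star_self_eq_zero_iff _ |>.mp h)

/-- If `x * q = x`, then also `|x| * q = |x|`, where `|x| = (x* x)^{1/2}`. -/
theorem sqrt_star_mul_self_mul_eq {A : Type*} [NonUnitalCStarAlgebra A] [PartialOrder A]
    [StarOrderedRing A] {x q : A} (h : x * q = x) :
    CFC.sqrt (star x * x) * q = CFC.sqrt (star x * x) := by
  have hs : star (CFC.sqrt (star x * x)) = CFC.sqrt (star x * x) :=
    (IsSelfAdjoint.of_nonneg (CFC.sqrt_nonneg _)).star_eq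
  have hm : CFC.sqrt (star x * x) * CFC.sqrt (star x * x) = star x * x :=
    CFC.sqrt_mul_sqrt_self _ (star_mul_self_nonneg x)
  generalize CFC.sqrt (star x * x) = a at hs hm ⊢
  have haq : a * (a * q) = a * a := by rw [← mul_assoc, hm, mul_assoc, h]
  refine sub_eq_zero.mp (CStarRing.star_mul_self_eq_zero_iff _ |>.mp ?_)
  simp only [star_sub, star_mul, hs, sub_mul, mul_sub, mul_assoc, haq, sub_self]

/-- If `x * f = x` for a projection `f`, then the ARP `p` of `x` satisfies `f * p = p`. -/
theorem IsARP.mul_eq_of_mul_eq {A : Type*} [NonUnitalCStarAlgebra A] {x p f : A}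
    (hp : IsARP x p) (hf : IsProjection f) (h : x * f = x) : f * p = p := by
  obtain ⟨⟨hps, hpp⟩, -, hp0⟩ := hp
  obtain ⟨hfs, hff⟩ := hf
  have h1 : p * (p - f * p) = 0 := hp0 _ (by rw [mul_sub, ← mul_assoc, h, sub_self])
  have h2 : f * (p - f * p) = 0 := by rw [mul_sub, ← mul_assoc, hff, sub_self]
  refine (sub_eq_zero.mp (CStarRing.star_mul_self_eq_zero_iff _ |>.mp ?_)).symm
  rw [star_sub, star_mul, hps, hfs, sub_mul, h1, mul_assoc, h2, mul_zero, sub_zero]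

/-- Let `x` be an element of a weakly Rickart C*-algebra `A` and let `e ∈ A` be a partial
isometry. Then `e` is the partial isometry in the polar decomposition of `x`
(i.e. `x = e (x* x)^{1/2}`, `e e* = LP(x)` and `e* e = RP(x)`) if, and only if, `x` is
a positive element of the C*-algebra `(A₂(e), •_e, *_e)` (equivalently, `x ∈ A₂(e)` and
`e* x ≥ 0` in `A`) and `A₀(e) = {x}^⊥`. -/
theorem polar_partial_isometry_characterization {A : Type*} [NonUnitalCStarAlgebra A]
    [PartialOrder A] [StarOrderedRing A]
    (hA : WeaklyRickart A) (x e : A) (he : IsPartialIsometry e) :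
    (x = e * CFC.sqrt (star x * x) ∧
        IsALP x (e * star e) ∧ IsARP x (star e * e)) ↔
      ((x ∈ Peirce2 e ∧ 0 ≤ star e * x) ∧ Peirce0 e = orthAnnihilator x) := by
  have hsl : star (e * star e) = e * star e := by simp
  have hsr : star (star e * e) = star e * e := by simp
  have hee : e * star e * e = e := he.mul_star_mul_self
  constructor
  · rintro ⟨hx, ⟨-, hlx, hl⟩, ⟨-, hxr, hr⟩⟩
    refine ⟨⟨?_, ?_⟩, ?_⟩
    · change e * star e * x * (star e * e) = x
      rw [hlx, hxr]
    · have h := congrArg star (sqrt_star_mul_self_mul_eq hxr)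
      rw [star_mul, hsr, (IsSelfAdjoint.of_nonneg (CFC.sqrt_nonneg (star x * x))).star_eq] at h
      have h' : star e * x = CFC.sqrt (star x * x) := by
        calc star e * x = star e * (e * CFC.sqrt (star x * x)) := by rw [← hx]
          _ = CFC.sqrt (star x * x) := by rw [← mul_assoc, h]
      rw [h']
      exact CFC.sqrt_nonneg _
    · ext y
      constructor
      · rintro ⟨h1, h2⟩
        have h1' := congrArg star h1
        have h2' := congrArg star h2
        rw [star_mul, hsl, star_zero] at h1'
        rw [star_mul, hsr, star_zero] at h2'
        constructor
        · rw [← hxr, mul_assoc, h2', mul_zero]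
        · rw [← hlx, ← mul_assoc, h1', zero_mul]
      · rintro ⟨h1, h2⟩
        have h1' := congrArg star (hr _ h1)
        have h2' := congrArg star (hl _ h2)
        rw [star_mul, hsr, star_zero, star_star] at h1'
        rw [star_mul, hsl, star_zero, star_star] at h2'
        exact ⟨h2', h1'⟩
  · rintro ⟨⟨hx2, hpos⟩, h0⟩
    replace hx2 : e * star e * x * (star e * e) = x := hx2
    have hf : IsProjection (star e * e) := ⟨hsr, by rw [mul_assoc, ← mul_assoc e, hee]⟩
    have hlx : e * star e * x = x := by
      conv_lhs => rw [← hx2]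
      rw [← mul_assoc, ← mul_assoc (e * star e), he.2, hx2]
    have hxr : x * (star e * e) = x := by
      conv_lhs => rw [← hx2]
      rw [mul_assoc, hf.2, hx2]
    have hsa : star x * e = star e * x := by
      simpa using (IsSelfAdjoint.of_nonneg hpos).star_eq
    have habs : CFC.sqrt (star x * x) = star e * x := by
      refine CFC.sqrt_unique ?_ hpos
      calc star e * x * (star e * x) = star x * e * (star e * x) := by rw [hsa]
        _ = star x * (e * star e * x) := by simp only [mul_assoc]
        _ = star x * x := by rw [hlx]
    obtain ⟨p, hp⟩ := hA x
    have hfp : star e * e * p = p := hp.mul_eq_of_mul_eq hf hxr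
    have hpr : x * (star e * e - p) = 0 := by rw [mul_sub, hxr, hp.2.1, sub_self]
    have hsp : star (star e * e - p) = star e * e - p := by rw [star_sub, hsr, hp.1.1]
    have hmem : e * (star e * e - p) ∈ Peirce0 e := by
      rw [h0]
      constructor
      · rw [star_mul, hsp, ← mul_assoc, hpr, zero_mul]
      · rw [star_mul, hsp, mul_assoc, ← hsa, ← hsp, ← mul_assoc, ← star_mul, hpr, star_zero,
          zero_mul]
    have hfeq : star e * e = p := by
      have h1 : e * (star e * e - p) = 0 := by
        have h := hmem.1
        rwa [← mul_assoc, hee] at h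
      have h2 : star e * e * (star e * e - p) = 0 := by rw [mul_assoc, h1, mul_zero]
      rw [mul_sub, hf.2, hfp] at h2
      exact sub_eq_zero.mp h2
    rw [← hfeq] at hp
    refine ⟨by rw [habs, ← mul_assoc, hlx], ⟨he, hlx, fun y hy => ?_⟩, hp⟩
    have h1 : x * (star e * star y) = 0 := by
      calc x * (star e * star y) = e * (star e * x) * (star e * star y) := by
            rw [← mul_assoc e, hlx]
        _ = e * star (y * (e * star e * x)) := by
            rw [← hsa]
            simp only [star_mul, star_star, mul_assoc]
        _ = 0 := by rw [hlx, hy, star_zero, mul_zero]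
    have h2 := congrArg star (hp.2.2 _ h1)
    rw [star_mul, hsr, star_mul, star_star, star_star, star_zero, mul_assoc, ← mul_assoc e,
      hee] at h2
    rw [← mul_assoc, h2, zero_mul]
end

section
/- Let A be a weakly Rickart C*-algebra, let x ∈ A be positive, let B be the norm closure of {x a x : a ∈ A}, and let C be a hereditary C*-subalgebra of A with b c = 0 and c b = 0 for all b ∈ B and c ∈ C. Then there exists a projection p ∈ A such that p b = b p = b for all b ∈ B and p c = c p = 0 for all c ∈ C. -/
/-- A hereditary C*-subalgebra: a norm-closed *-subalgebra `C` such that `0 ≤ a ≤ b`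
with `b ∈ C` implies `a ∈ C`. -/
def IsHereditary {A : Type*} [NonUnitalCStarAlgebra A] [PartialOrder A]
    (C : NonUnitalStarSubalgebra ℂ A) : Prop :=
  IsClosed (C : Set A) ∧ ∀ a b : A, 0 ≤ a → a ≤ b → b ∈ C → a ∈ C

/-- In a C*-algebra, a self-adjoint `x` with `x * (x * y) = 0` satisfies `x * y = 0`. -/
theorem IsSelfAdjoint.mul_eq_zero_of_mul_mul_eq_zero {A : Type*} [NonUnitalCStarAlgebra A]
    {x y : A} (hx : IsSelfAdjoint x) (h : x * (x * y) = 0) : x * y = 0 := by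
  rw [← CStarRing.star_mul_self_eq_zero_iff, star_mul, hx.star_eq, mul_assoc, h, mul_zero]

/-- Let `A` be a weakly Rickart C*-algebra, `x ∈ A` positive, `B` the norm closure of
`x A x` and `C` a hereditary C*-subalgebra of `A` orthogonal to `B` (all mutual products
vanish). Then there is a projection `p ∈ A` which is a unit for `B` and annihilates
`C`. -/
theorem weaklyRickart_projection_unit_for_sigma_unital_hereditary {A : Type*}
    [NonUnitalCStarAlgebra A] [PartialOrder A] [StarOrderedRing A]
    (hA : WeaklyRickart A) (x : A) (hx : 0 ≤ x)
    (C : NonUnitalStarSubalgebra ℂ A) (hC : IsHereditary C)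
    (horth : ∀ b ∈ closure {w : A | ∃ a : A, w = x * a * x}, ∀ c ∈ C,
      b * c = 0 ∧ c * b = 0) :
    ∃ p : A, IsProjection p ∧
      (∀ b ∈ closure {w : A | ∃ a : A, w = x * a * x}, p * b = b ∧ b * p = b) ∧
      (∀ c ∈ C, p * c = 0 ∧ c * p = 0) := by
  obtain ⟨p, hp, hxp, hann⟩ := hA x
  have hsa : IsSelfAdjoint x := .of_nonneg hx
  have hpx : p * x = x := by
    simpa [star_mul, hp.1, hsa.star_eq] using congrArg star hxp
  have hpC : ∀ c ∈ C, p * c = 0 := fun c hc ↦ by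
    have h := (horth (x * x * x) (subset_closure ⟨x, rfl⟩) c hc).1
    simp only [mul_assoc] at h
    exact hann c (hsa.mul_eq_zero_of_mul_mul_eq_zero (hsa.mul_eq_zero_of_mul_mul_eq_zero h))
  refine ⟨p, hp, fun b hb ↦ ?_, fun c hc ↦ ⟨hpC c hc, ?_⟩⟩
  · have hclosed : IsClosed {b : A | p * b = b ∧ b * p = b} :=
      (isClosed_eq (by fun_prop) continuous_id).inter (isClosed_eq (by fun_prop) continuous_id)
    refine closure_minimal ?_ hclosed hb
    rintro _ ⟨a, rfl⟩
    exact ⟨by rw [← mul_assoc, ← mul_assoc, hpx], by rw [mul_assoc, hxp]⟩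
  · simpa [star_mul, hp.1] using congrArg star (hpC (star c) (star_mem hc))
end
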